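/- For every n ≥ 2, γ ∈ (0,1), 0 < λ ≤ Λ and K > 0 there exist constants c̄ > 0 and C̄ > 0 with the following property. Let A be as in the context with [A]_{C^{0,γ}} ≤ K, let 0 < r ≤ 1, let f be bounded measurable on B_r(x₀), and let v be continuous on the closed ball B̄_r(x₀) and locally Lipschitz in B_r(x₀), with v ≥ 0, 𝓛v = f weakly in B_r(x₀), and v(y₀) = 0 for some y₀ ∈ ∂B_r(x₀). Let ν denote the inner unit normal to ∂B_r(x₀) at y₀. Then there exists α ≥ c̄·v(x₀)/r − C̄·r·‖f‖∞ such that v(x) ≥ α⟨x − y₀, ν⟩⁺ + o(|x − y₀|) as x → y₀ in B_r(x₀), that is, liminf_{x→y₀} (v(x) − α⟨x − y₀, ν⟩⁺)/|x − y₀| ≥ 0. -/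

import Mathlib

open Set Filter MeasureTheory Metric Bornology
open scoped Topology RealInnerProductSpace ENNReal NNReal

noncomputable section

/-- Euclidean space `ℝⁿ`. -/
abbrev EucSp (n : ℕ) := EuclideanSpace ℝ (Fin n)

variable {n : ℕ}

/-- Uniform ellipticity of the coefficient field `A` on the set `s`:
`λ|ξ|² ≤ ⟨A(x)ξ, ξ⟩ ≤ Λ|ξ|²`. -/
def IsElliptic (A : EucSp n → (EucSp n →L[ℝ] EucSp n)) (lam Lam : ℝ)
    (s : Set (EucSp n)) : Prop :=
  ∀ x ∈ s, ∀ ξ : EucSp n,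
    lam * ‖ξ‖ ^ 2 ≤ ⟪A x ξ, ξ⟫ ∧ ⟪A x ξ, ξ⟫ ≤ Lam * ‖ξ‖ ^ 2

/-- Symmetry of the coefficient field on `s`. -/
def IsSymmCoeff (A : EucSp n → (EucSp n →L[ℝ] EucSp n)) (s : Set (EucSp n)) : Prop :=
  ∀ x ∈ s, ∀ ξ η : EucSp n, ⟪A x ξ, η⟫ = ⟪ξ, A x η⟫

/-- `A` is Hölder continuous with exponent `γ` and seminorm at most `K` on `s`. -/
def HolderSemi (A : EucSp n → (EucSp n →L[ℝ] EucSp n)) (γ K : ℝ)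
    (s : Set (EucSp n)) : Prop :=
  ∀ x ∈ s, ∀ y ∈ s, ‖A x - A y‖ ≤ K * ‖x - y‖ ^ γ

/-- `v` is locally Lipschitz on the set `s`. -/
def LocLipOn (v : EucSp n → ℝ) (s : Set (EucSp n)) : Prop :=
  ∀ x ∈ s, ∃ K : ℝ≥0, ∃ t ∈ 𝓝[s] x, LipschitzOnWith K v t

/-- A test function for the weak formulation in the open set `D`:
smooth with compact support contained in `D`. -/
def IsTest (D : Set (EucSp n)) (φ : EucSp n → ℝ) : Prop :=
  ContDiff ℝ (⊤ : ℕ∞) φ ∧ HasCompactSupport φ ∧ tsupport φ ⊆ D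

/-- `𝓛 v = div(A ∇ v) = f` weakly in `D`:
`∫_D ⟨A(x)∇v, ∇φ⟩ = −∫_D f φ` for every test function `φ`. -/
def WeakEq (A : EucSp n → (EucSp n →L[ℝ] EucSp n)) (v f : EucSp n → ℝ)
    (D : Set (EucSp n)) : Prop :=
  ∀ φ : EucSp n → ℝ, IsTest D φ →
    ∫ x in D, ⟪A x (gradient v x), gradient φ x⟫ = - ∫ x in D, f x * φ x

/-- `𝓛 v ≥ f` weakly in `D`:
`∫_D ⟨A(x)∇v, ∇φ⟩ ≤ −∫_D f φ` for every nonnegative test function `φ`. -/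
def WeakGe (A : EucSp n → (EucSp n →L[ℝ] EucSp n)) (v f : EucSp n → ℝ)
    (D : Set (EucSp n)) : Prop :=
  ∀ φ : EucSp n → ℝ, IsTest D φ → (∀ x, 0 ≤ φ x) →
    ∫ x in D, ⟪A x (gradient v x), gradient φ x⟫ ≤ - ∫ x in D, f x * φ x

/-- `𝓛 v ≤ f` weakly in `D`:
`∫_D ⟨A(x)∇v, ∇φ⟩ ≥ −∫_D f φ` for every nonnegative test function `φ`. -/
def WeakLe (A : EucSp n → (EucSp n →L[ℝ] EucSp n)) (v f : EucSp n → ℝ)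
    (D : Set (EucSp n)) : Prop :=
  ∀ φ : EucSp n → ℝ, IsTest D φ → (∀ x, 0 ≤ φ x) →
    - ∫ x in D, f x * φ x ≤ ∫ x in D, ⟪A x (gradient v x), gradient φ x⟫

/-- The positive part `v⁺ = max(v, 0)`. -/
def PPart (v : EucSp n → ℝ) : EucSp n → ℝ := fun x => max (v x) 0

/-- The negative part `v⁻ = max(−v, 0)`. -/
def NPart (v : EucSp n → ℝ) : EucSp n → ℝ := fun x => max (-v x) 0

/-- The right-hand side `f·χ_{v<0}`. -/
def ChiNeg (f v : EucSp n → ℝ) : EucSp n → ℝ := fun x => if v x < 0 then f x else 0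

/-- `Ω⁺(v) = {x ∈ Ω : v(x) > 0}`. -/
def plusSet (Ω : Set (EucSp n)) (v : EucSp n → ℝ) : Set (EucSp n) :=
  {x ∈ Ω | 0 < v x}

/-- `Ω⁻(v)` = interior of `{x ∈ Ω : v(x) ≤ 0}`. -/
def minusSet (Ω : Set (EucSp n)) (v : EucSp n → ℝ) : Set (EucSp n) :=
  interior {x ∈ Ω | v x ≤ 0}

/-- The free boundary `F(v) = ∂{v > 0} ∩ Ω`. -/
def freeBdry (Ω : Set (EucSp n)) (v : EucSp n → ℝ) : Set (EucSp n) :=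
  frontier (plusSet Ω v) ∩ Ω

/-- `x₀ ∈ F(v)` is regular from the right, via the touching ball `B(y,r) ⊆ Ω⁺(v)`
with `B̄ ∩ F(v) = {x₀}`. -/
def TouchRight (Ω : Set (EucSp n)) (v : EucSp n → ℝ) (x₀ y : EucSp n) (r : ℝ) : Prop :=
  0 < r ∧ ball y r ⊆ plusSet Ω v ∧ closure (ball y r) ∩ freeBdry Ω v = {x₀}

/-- `x₀ ∈ F(v)` is regular from the left, via the touching ball `B(y,r) ⊆ Ω⁻(v)`
with `B̄ ∩ F(v) = {x₀}`. -/
def TouchLeft (Ω : Set (EucSp n)) (v : EucSp n → ℝ) (x₀ y : EucSp n) (r : ℝ) : Prop :=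
  0 < r ∧ ball y r ⊆ minusSet Ω v ∧ closure (ball y r) ∩ freeBdry Ω v = {x₀}

/-- The unit normal at `x₀` to a ball centered at `y` touching `F(v)` from the
right at `x₀`, pointing towards `Ω⁺(v)`, i.e. into the ball. -/
def nuRight (x₀ y : EucSp n) : EucSp n := ‖y - x₀‖⁻¹ • (y - x₀)

/-- The unit normal at `x₀` to a ball centered at `y` touching `F(v)` from the
left at `x₀`, pointing towards `Ω⁺(v)`, i.e. away from the ball. -/
def nuLeft (x₀ y : EucSp n) : EucSp n := ‖x₀ - y‖⁻¹ • (x₀ - y)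

/-- `v(x) ≤ α⟨x − x₀, ν⟩⁺ + o(|x − x₀|)` as `x → x₀` within `s`. -/
def ExpandLe (v : EucSp n → ℝ) (x₀ ν : EucSp n) (α : ℝ) (s : Set (EucSp n)) : Prop :=
  ∀ ε > (0:ℝ), ∀ᶠ x in 𝓝[s] x₀,
    v x ≤ α * max ⟪x - x₀, ν⟫ 0 + ε * ‖x - x₀‖

/-- `v(x) ≥ α⟨x − x₀, ν⟩⁺ + o(|x − x₀|)` as `x → x₀` within `s`. -/
def ExpandGe (v : EucSp n → ℝ) (x₀ ν : EucSp n) (α : ℝ) (s : Set (EucSp n)) : Prop :=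
  ∀ ε > (0:ℝ), ∀ᶠ x in 𝓝[s] x₀,
    α * max ⟪x - x₀, ν⟫ 0 - ε * ‖x - x₀‖ ≤ v x

/-- `v(x) = o(|x − x₀|)` as `x → x₀` within `s`. -/
def SmallO (v : EucSp n → ℝ) (x₀ : EucSp n) (s : Set (EucSp n)) : Prop :=
  ∀ ε > (0:ℝ), ∀ᶠ x in 𝓝[s] x₀, |v x| ≤ ε * ‖x - x₀‖

/-- The non-tangential cone at `x₀` in direction `ν` with opening parameter `θ`. -/
def ntCone (x₀ ν : EucSp n) (θ : ℝ) : Set (EucSp n) :=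
  {x | θ * ‖x - x₀‖ < ⟪x - x₀, ν⟫}

/-- Hypotheses on the free boundary condition function `G(β, x, ν)`: strictly
increasing in `β ≥ 0`, Lipschitz in all arguments, and
`G(0) := inf_{x ∈ Ω, |ν|=1} G(0, x, ν) ≥ G0 > 0`. -/
def GHyp (Ω : Set (EucSp n)) (G : ℝ → EucSp n → EucSp n → ℝ) (G0 : ℝ) : Prop :=
  (∀ x ν, StrictMonoOn (fun β => G β x ν) (Ici (0:ℝ))) ∧
  (∃ LG : ℝ≥0, LipschitzWith LG (fun p : ℝ × EucSp n × EucSp n => G p.1 p.2.1 p.2.2)) ∧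
  0 < G0 ∧ ∀ x ∈ Ω, ∀ ν : EucSp n, ‖ν‖ = 1 → G0 ≤ G 0 x ν

/-- A (crude) notion of bounded Lipschitz domain: bounded, open, and near every
boundary point, `Ω` is the supergraph of a Lipschitz function in some direction. -/
def IsLipschitzDomain (Ω : Set (EucSp n)) : Prop :=
  IsOpen Ω ∧ IsBounded Ω ∧ Ω.Nonempty ∧
  ∀ x ∈ frontier Ω, ∃ r : ℝ, 0 < r ∧ ∃ (g : EucSp n → ℝ) (L : ℝ≥0) (e : EucSp n),
    ‖e‖ = 1 ∧ LipschitzWith L g ∧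
    ∀ y ∈ ball x r, (y ∈ Ω ↔ g (y - ⟪y, e⟫ • e) < ⟪y, e⟫)

/-- The class `𝓕` of admissible supersolutions (Definition 1.2). -/
def memF (A : EucSp n → (EucSp n →L[ℝ] EucSp n)) (Ω : Set (EucSp n))
    (f₁ f₂ : EucSp n → ℝ) (G : ℝ → EucSp n → EucSp n → ℝ) (w : EucSp n → ℝ) : Prop :=
  ContinuousOn w (closure Ω) ∧ LocLipOn w (closure Ω) ∧
  WeakLe A w f₁ (plusSet Ω w) ∧
  WeakLe A w (ChiNeg f₂ w) (minusSet Ω w) ∧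
  (∀ x₀ y r, TouchLeft Ω w x₀ y r →
    ∃ α β : ℝ, 0 ≤ α ∧ 0 ≤ β ∧
      ExpandLe (PPart w) x₀ (nuLeft x₀ y) α Set.univ ∧
      ExpandGe (NPart w) x₀ (-(nuLeft x₀ y)) β Set.univ ∧
      α < G β x₀ (nuLeft x₀ y)) ∧
  (∀ x₀ ∈ freeBdry Ω w, (∀ y r, ¬ TouchLeft Ω w x₀ y r) → SmallO w x₀ Set.univ)

/-- A minorant (strict subsolution) for the free boundary problem. -/
def IsMinorant (A : EucSp n → (EucSp n →L[ℝ] EucSp n)) (Ω : Set (EucSp n))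
    (f₁ f₂ : EucSp n → ℝ) (G : ℝ → EucSp n → EucSp n → ℝ) (u : EucSp n → ℝ) : Prop :=
  LocLipOn u Ω ∧
  WeakGe A u f₁ (plusSet Ω u) ∧
  WeakGe A u (ChiNeg f₂ u) (minusSet Ω u) ∧
  ∀ x₀ ∈ freeBdry Ω u, ∃ y r, TouchRight Ω u x₀ y r ∧
    ∃ α β : ℝ, 0 ≤ α ∧ 0 ≤ β ∧
      ExpandGe (PPart u) x₀ (nuRight x₀ y) α Set.univ ∧
      ExpandLe (NPart u) x₀ (-(nuRight x₀ y)) β Set.univ ∧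
      G β x₀ (nuRight x₀ y) < α

/-- A weak solution of the two-phase free boundary problem (Definition 1.1). -/
def IsWeakSolution (A : EucSp n → (EucSp n →L[ℝ] EucSp n)) (Ω : Set (EucSp n))
    (f₁ f₂ : EucSp n → ℝ) (G : ℝ → EucSp n → EucSp n → ℝ) (u : EucSp n → ℝ) : Prop :=
  ContinuousOn u Ω ∧
  WeakEq A u f₁ (plusSet Ω u) ∧
  WeakEq A u (ChiNeg f₂ u) (minusSet Ω u) ∧
  (∀ x₀ y r, TouchRight Ω u x₀ y r →
    ∃ α β : ℝ, 0 ≤ α ∧ 0 ≤ β ∧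
      ExpandGe (PPart u) x₀ (nuRight x₀ y) α (ball y r) ∧
      ExpandLe (NPart u) x₀ (-(nuRight x₀ y)) β (closure (ball y r))ᶜ ∧
      (∀ θ ∈ Ioo (0:ℝ) 1,
        SmallO (fun x => PPart u x - α * ⟪x - x₀, nuRight x₀ y⟫) x₀
          (ntCone x₀ (nuRight x₀ y) θ) ∧
        SmallO (fun x => NPart u x - β * ⟪x - x₀, -(nuRight x₀ y)⟫) x₀
          (ntCone x₀ (-(nuRight x₀ y)) θ)) ∧
      α ≤ G β x₀ (nuRight x₀ y)) ∧
  (∀ x₀ y r, TouchLeft Ω u x₀ y r →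
    ∃ α β : ℝ, 0 ≤ α ∧ 0 ≤ β ∧
      ExpandGe (NPart u) x₀ (-(nuLeft x₀ y)) β (ball y r) ∧
      ExpandLe (PPart u) x₀ (nuLeft x₀ y) α (closure (ball y r))ᶜ ∧
      (∀ θ ∈ Ioo (0:ℝ) 1,
        SmallO (fun x => PPart u x - α * ⟪x - x₀, nuLeft x₀ y⟫) x₀
          (ntCone x₀ (nuLeft x₀ y) θ) ∧
        SmallO (fun x => NPart u x - β * ⟪x - x₀, -(nuLeft x₀ y)⟫) x₀
          (ntCone x₀ (-(nuLeft x₀ y)) θ)) ∧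
      G β x₀ (nuLeft x₀ y) ≤ α)

/-- The Perron family: admissible supersolutions above the minorant `ubar`
with boundary values `φb`. -/
def PerronFam (A : EucSp n → (EucSp n →L[ℝ] EucSp n)) (Ω : Set (EucSp n))
    (f₁ f₂ : EucSp n → ℝ) (G : ℝ → EucSp n → EucSp n → ℝ)
    (ubar φb : EucSp n → ℝ) : Set (EucSp n → ℝ) :=
  {w | memF A Ω f₁ f₂ G w ∧ (∀ x ∈ closure Ω, ubar x ≤ w x) ∧
       ∀ x ∈ frontier Ω, w x = φb x}

open scoped Convolution in
/-- The derivative of a mollified Lipschitz function is the mollified derivative. -/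
theorem hasFDerivAt_normed_convolution {φ : EucSp n → ℝ} {L : ℝ≥0} (hφ : LipschitzWith L φ)
    (η : ContDiffBump (0 : EucSp n)) (x : EucSp n) :
    HasFDerivAt (η.normed volume ⋆[ContinuousLinearMap.lsmul ℝ ℝ, volume] φ)
      ((η.normed volume ⋆[ContinuousLinearMap.lsmul ℝ ℝ, volume] (fderiv ℝ φ)) x) x := by
  have hη := η.integrable_normed (μ := (volume : Measure (EucSp n)))
  have hcomp : HasCompactSupport (η.normed (volume : Measure (EucSp n))) :=
    η.hasCompactSupport_normed
  have hcont := η.continuous_normed (μ := (volume : Measure (EucSp n)))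
  have key := hasFDerivAt_integral_of_dominated_loc_of_lip (𝕜 := ℝ)
    (μ := (volume : Measure (EucSp n))) (x₀ := x) (s := univ)
    (F := fun x t => η.normed volume t • φ (x - t))
    (F' := fun t => η.normed volume t • fderiv ℝ φ (x - t))
    (bound := fun t => η.normed volume t * L) univ_mem ?_ ?_ ?_ ?_ ?_ ?_
  · exact key.2
  · refine Eventually.of_forall fun y => Continuous.aestronglyMeasurable ?_
    exact hcont.smul (hφ.continuous.comp (by fun_prop))
  · refine Continuous.integrable_of_hasCompactSupport ?_ hcomp.smul_right
    exact hcont.smul (hφ.continuous.comp (by fun_prop))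
  · refine hcont.aestronglyMeasurable.smul ?_
    exact ((measurable_fderiv ℝ φ).comp (by fun_prop)).aestronglyMeasurable
  · refine Eventually.of_forall fun t => LipschitzWith.lipschitzOnWith ?_
    refine LipschitzWith.of_dist_le_mul fun y z => ?_
    rw [dist_eq_norm, ← smul_sub, norm_smul, Real.norm_of_nonneg (η.nonneg_normed t),
      Real.coe_nnabs, abs_of_nonneg (a := η.normed volume t * L)
        (mul_nonneg (η.nonneg_normed t) L.2), mul_assoc]
    gcongr
    · exact η.nonneg_normed t
    · have := hφ.dist_le_mul (y - t) (z - t)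
      rwa [dist_sub_right, dist_eq_norm] at this
  · exact hη.mul_const _
  · have h1 : ∀ᵐ y : EucSp n, DifferentiableAt ℝ φ y := hφ.ae_differentiableAt
    have h2 : ∀ᵐ t : EucSp n, DifferentiableAt ℝ φ (x - t) :=
      (Measure.measurePreserving_sub_left volume x).quasiMeasurePreserving.ae h1
    filter_upwards [h2] with t ht
    have h3 : HasFDerivAt (fun y => φ (y - t)) (fderiv ℝ φ (x - t)) x := by
      simp_rw [sub_eq_add_neg] at ht ⊢
      exact (hasFDerivAt_comp_add_right (-t)).2 ht.hasFDerivAt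
    exact h3.const_smul (η.normed volume t)

open scoped Convolution in
/-- Weak inequalities tested against smooth functions extend to Lipschitz test functions. -/
theorem lipschitz_test {F : EucSp n → EucSp n} {R ρ b M : ℝ} (hρ : ρ < R)
    (hFm : AEStronglyMeasurable F (volume.restrict (ball 0 R)))
    (hFb : ∀ x ∈ ball (0 : EucSp n) R, ‖F x‖ ≤ b)
    (h : ∀ φ, IsTest (ball 0 R) φ →
      |∫ x in ball (0 : EucSp n) R, fderiv ℝ φ x (F x)| ≤ M * ∫ x, |φ x|)
    {φ : EucSp n → ℝ} {L : ℝ≥0} (hφ : LipschitzWith L φ) (hφ0 : ∀ x, ρ < ‖x‖ → φ x = 0) :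
    |∫ x in ball (0 : EucSp n) R, fderiv ℝ φ x (F x)| ≤ M * ∫ x, |φ x| := by
  set δ := (R - ρ) / 4 with hδ
  have hδ0 : 0 < δ := by rw [hδ]; linarith
  have hpos : ∀ i : ℕ, 0 < δ / (i + 1) := fun i => by positivity
  let η : ℕ → ContDiffBump (0 : EucSp n) := fun i =>
    ⟨δ / (i + 1), 2 * (δ / (i + 1)), hpos i, by linarith [hpos i]⟩
  have hle : ∀ i : ℕ, δ / (i + 1) ≤ δ := fun i => by
    rw [div_le_iff₀ (by positivity)]
    nlinarith [show (0 : ℝ) ≤ i from Nat.cast_nonneg i]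
  have hrout : Tendsto (fun i => (η i).rOut) atTop (𝓝 0) := by
    have h1 : Tendsto (fun i : ℕ => 2 * (δ / ((i : ℝ) + 1))) atTop (𝓝 (2 * 0)) :=
      ((tendsto_const_div_atTop_nhds_zero_nat δ).comp (tendsto_add_atTop_nat 1) |>.congr
        fun i => by simp).const_mul 2
    simpa using h1
  let ψ : ℕ → EucSp n → ℝ := fun i =>
    (η i).normed volume ⋆[ContinuousLinearMap.lsmul ℝ ℝ, volume] φ
  have hφm : ∀ᵐ x, Tendsto (fun i => ((η i).normed volume
      ⋆[ContinuousLinearMap.lsmul ℝ ℝ, volume] (fderiv ℝ φ)) x) atTop (𝓝 (fderiv ℝ φ x)) := by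
    refine ContDiffBump.ae_convolution_tendsto_right_of_locallyIntegrable (K := 2) hrout
      (Eventually.of_forall fun i => le_rfl) ?_
    refine (locallyIntegrable_const (L : ℝ)).mono
      (measurable_fderiv ℝ φ).aestronglyMeasurable (Eventually.of_forall fun x => ?_)
    simpa using norm_fderiv_le_of_lipschitz ℝ hφ
  have hclose : ∀ i x, |ψ i x - φ x| ≤ L * (2 * (δ / (i + 1))) := fun i x => by
    have := ContDiffBump.dist_normed_convolution_le (μ := (volume : Measure (EucSp n)))
      (φ := η i) (g := φ) (x₀ := x) (ε := L * (2 * (δ / (i + 1))))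
      hφ.continuous.aestronglyMeasurable (fun y hy => ?_)
    · simpa [Real.dist_eq] using this
    · refine (hφ.dist_le_mul y x).trans ?_
      gcongr
      exact (mem_ball.1 hy).le
  have hψ0 : ∀ i x, ρ + 2 * δ < ‖x‖ → ψ i x = 0 := fun i x hx => by
    refine integral_eq_zero_of_ae (Eventually.of_forall fun t => ?_)
    by_cases ht : t ∈ ball (0 : EucSp n) (η i).rOut
    · have h1 : ‖t‖ < 2 * (δ / (i + 1)) := by simpa using ht
      have h2 : φ (x - t) = 0 := hφ0 _ (by linarith [norm_sub_norm_le x t, hle i])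
      simp [h2]
    · rw [← (η i).support_normed_eq (μ := (volume : Measure (EucSp n)))] at ht
      simp [Function.notMem_support.1 ht]
  have htest : ∀ i, IsTest (ball 0 R) (ψ i) := fun i => by
    have hsub : tsupport (ψ i) ⊆ closedBall 0 (ρ + 2 * δ) := by
      refine closure_minimal (fun x hx => ?_) isClosed_closedBall
      by_contra hx'
      exact hx (hψ0 i x (by simpa using hx'))
    refine ⟨?_, ?_, hsub.trans (closedBall_subset_ball (by rw [hδ]; linarith))⟩
    · exact (η i).hasCompactSupport_normed.contDiff_convolution_left _
        ((η i).contDiff_normed) hφ.continuous.locallyIntegrable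
    · exact (isCompact_closedBall _ _).of_isClosed_subset (isClosed_tsupport _) hsub
  have hfd : ∀ i x, fderiv ℝ (ψ i) x = ((η i).normed volume
      ⋆[ContinuousLinearMap.lsmul ℝ ℝ, volume] (fderiv ℝ φ)) x := fun i x =>
    (hasFDerivAt_normed_convolution hφ (η i) x).fderiv
  have hfdb : ∀ i x, ‖fderiv ℝ (ψ i) x‖ ≤ L := fun i x => by
    rw [hfd]
    have hb : ∀ t, ‖(η i).normed volume t • fderiv ℝ φ (x - t)‖
        ≤ (η i).normed volume t * L := fun t => by
      rw [norm_smul, Real.norm_of_nonneg ((η i).nonneg_normed t)]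
      exact mul_le_mul_of_nonneg_left (norm_fderiv_le_of_lipschitz ℝ hφ)
        ((η i).nonneg_normed t)
    refine (norm_integral_le_of_norm_le ((η i).integrable_normed.mul_const (L : ℝ))
      (Eventually.of_forall hb)).trans ?_
    rw [integral_mul_const, (η i).integral_normed, one_mul]
  have hlim1 : Tendsto (fun i => ∫ x in ball (0 : EucSp n) R, fderiv ℝ (ψ i) x (F x)) atTop
      (𝓝 (∫ x in ball (0 : EucSp n) R, fderiv ℝ φ x (F x))) := by
    refine tendsto_integral_of_dominated_convergence (fun _ => L * b) (fun i => ?_) ?_ ?_ ?_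
    · exact (ContinuousLinearMap.id ℝ (EucSp n →L[ℝ] ℝ)).aestronglyMeasurable_comp₂
        (measurable_fderiv ℝ (ψ i)).aestronglyMeasurable hFm
    · exact integrableOn_const measure_ball_lt_top.ne
    · intro i
      refine (ae_restrict_iff' measurableSet_ball).2 (Eventually.of_forall fun x hx => ?_)
      exact (ContinuousLinearMap.le_opNorm _ _).trans
        (mul_le_mul (hfdb i x) (hFb x hx) (norm_nonneg _) L.2)
    · refine ae_restrict_of_ae ?_
      filter_upwards [hφm] with x hx
      simp_rw [hfd]
      exact ((ContinuousLinearMap.apply ℝ ℝ (F x)).continuous.tendsto _).comp hx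
  have hlim2 : Tendsto (fun i => M * ∫ x, |ψ i x|) atTop (𝓝 (M * ∫ x, |φ x|)) := by
    refine Tendsto.const_mul _ ?_
    obtain ⟨C, hC⟩ := hφ.continuous.bounded_above_of_compact_support
      ((isCompact_closedBall (0 : EucSp n) ρ).of_isClosed_subset (isClosed_tsupport φ)
        (closure_minimal (fun x hx => by
          by_contra hx'
          exact hx (hφ0 x (by simpa using hx'))) isClosed_closedBall))
    refine tendsto_integral_of_dominated_convergence
      ((closedBall 0 (ρ + 2 * δ)).indicator fun _ => C + L * (2 * δ)) (fun i => ?_) ?_ ?_ ?_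
    · exact ((htest i).1.continuous.abs).aestronglyMeasurable
    · exact (integrable_indicator_iff measurableSet_closedBall).2
        (integrableOn_const (hs := (isCompact_closedBall _ _).measure_lt_top.ne))
    · refine fun i => Eventually.of_forall fun x => ?_
      by_cases hx : x ∈ closedBall (0 : EucSp n) (ρ + 2 * δ)
      · rw [indicator_of_mem hx, Real.norm_eq_abs, abs_abs]
        have h1 := hclose i x
        have h2 := hC x
        rw [Real.norm_eq_abs] at h2
        have h3 : (L : ℝ) * (2 * (δ / (i + 1))) ≤ L * (2 * δ) := by
          gcongr
          exact hle i
        have := abs_sub_abs_le_abs_sub (ψ i x) (φ x)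
        linarith
      · rw [indicator_of_notMem hx, hψ0 i x (by simpa using hx)]
        simp
    · refine Eventually.of_forall fun x => Tendsto.abs ?_
      exact ContDiffBump.convolution_tendsto_right_of_continuous hrout hφ.continuous x
  exact le_of_tendsto_of_tendsto' hlim1.abs hlim2 fun i => h _ (htest i)

/-- `|div(A ∇v)| ≤ M` weakly in `D`, expressed by duality. -/
def WeakBdd (A : EucSp n → (EucSp n →L[ℝ] EucSp n)) (v : EucSp n → ℝ) (M : ℝ)
    (D : Set (EucSp n)) : Prop :=
  ∀ φ : EucSp n → ℝ, IsTest D φ →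
    |∫ x in D, fderiv ℝ φ x (A x (gradient v x))| ≤ M * ∫ x, |φ x|

theorem IsTest.integrable {D : Set (EucSp n)} {φ : EucSp n → ℝ} (h : IsTest D φ) :
    Integrable φ :=
  h.1.continuous.integrable_of_hasCompactSupport h.2.1

theorem WeakEq.weakBdd {A : EucSp n → (EucSp n →L[ℝ] EucSp n)} {v f : EucSp n → ℝ} {M : ℝ}
    {D : Set (EucSp n)} (h : WeakEq A v f D) (hD : MeasurableSet D) (hM : 0 ≤ M)
    (hf : ∀ x ∈ D, |f x| ≤ M) : WeakBdd A v M D := by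
  intro φ hφ
  have h1 := h φ hφ
  simp only [inner_gradient_right, conj_trivial] at h1
  rw [h1, abs_neg, ← integral_const_mul]
  have hint : Integrable (fun x => M * |φ x|) := hφ.integrable.abs.const_mul M
  have hle : ∀ᵐ x ∂volume.restrict D, ‖f x * φ x‖ ≤ M * |φ x| := by
    refine (ae_restrict_iff' hD).2 (Eventually.of_forall fun x hx => ?_)
    rw [norm_mul, Real.norm_eq_abs, Real.norm_eq_abs]
    exact mul_le_mul_of_nonneg_right (hf x hx) (abs_nonneg _)
  exact (norm_integral_le_of_norm_le hint.integrableOn hle).trans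
    (setIntegral_le_integral hint (Eventually.of_forall fun x => by positivity))

theorem fderiv_comp_affine (g : EucSp n → ℝ) (x z : EucSp n) (s : ℝ) :
    fderiv ℝ (fun z => g (x + s • z)) z = s • fderiv ℝ g (x + s • z) := by
  rw [← fderiv_comp_add_left (f := g) x]
  exact fderiv_comp_smul (f := fun w : EucSp n => g (x + w)) (x := z) s

theorem gradient_comp_affine (g : EucSp n → ℝ) (x z : EucSp n) (s : ℝ) :
    gradient (fun z => g (x + s • z)) z = s • gradient g (x + s • z) := by
  simp [gradient, fderiv_comp_affine]

theorem integral_comp_affine (g : EucSp n → ℝ) (x : EucSp n) {s : ℝ} (hs : 0 < s) :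
    ∫ z, g (x + s • z) = (s ^ n)⁻¹ * ∫ y, g y := by
  rw [Measure.integral_comp_smul volume (fun w => g (x + w)) s,
    integral_add_left_eq_self (fun w => g w) x, finrank_euclideanSpace_fin,
    abs_of_pos (by positivity), smul_eq_mul]

theorem fderiv_eq_zero_of_notMem_tsupport {φ : EucSp n → ℝ} {x : EucSp n}
    (hx : x ∉ tsupport φ) : fderiv ℝ φ x = 0 := by
  have h := support_fderiv_subset ℝ (f := φ)
  exact Function.notMem_support.1 fun hx' => hx (h hx')

/-- Rescaling a ball to a ball centered at the origin. -/
theorem WeakBdd.rescale {A : EucSp n → (EucSp n →L[ℝ] EucSp n)} {v g : EucSp n → ℝ} {M : ℝ}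
    {D : Set (EucSp n)} (h : WeakBdd A v M D) {x : EucSp n} {s R : ℝ} (hs : 0 < s)
    (hD : ball x (s * R) ⊆ D) (hg : EqOn g v (ball x (s * R))) :
    WeakBdd (fun z => A (x + s • z)) (fun z => g (x + s • z)) (s ^ 2 * M) (ball 0 R) := by
  intro φ hφ
  let e : EucSp n ≃ₜ EucSp n :=
    (Homeomorph.subRight x).trans (Homeomorph.smulOfNeZero s⁻¹ (inv_ne_zero hs.ne'))
  have he : ∀ y, e y = s⁻¹ • (y - x) := fun y => rfl
  have he' : ∀ z, e (x + s • z) = z := fun z => by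
    rw [he, add_sub_cancel_left, smul_smul, inv_mul_cancel₀ hs.ne', one_smul]
  have hball : ∀ y, e y ∈ ball (0 : EucSp n) R → y ∈ ball x (s * R) := fun y hy => by
    rw [he, mem_ball_zero_iff, norm_smul, norm_inv, Real.norm_of_nonneg hs.le,
      inv_mul_lt_iff₀ hs] at hy
    rwa [mem_ball, dist_eq_norm]
  set φ' : EucSp n → ℝ := φ ∘ e with hφ'
  have hts : tsupport φ' ⊆ e ⁻¹' tsupport φ := tsupport_comp_subset_preimage _ e.continuous
  have hsub : tsupport φ' ⊆ D := fun y hy => hD (hball y (hφ.2.2 (hts hy)))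
  have htest : IsTest D φ' := by
    refine ⟨hφ.1.comp ?_, hφ.2.1.comp_homeomorph e, hsub⟩
    change ContDiff ℝ _ fun y : EucSp n => s⁻¹ • (y - x)
    fun_prop
  have hφe : φ = fun z => φ' (x + s • z) := by
    funext z
    simp [hφ', he']
  have h1 := h φ' htest
  set G : EucSp n → ℝ := fun y => fderiv ℝ φ' y (A y (gradient v y)) with hG
  have hGD : ∫ y in D, G y = ∫ y, G y := by
    refine setIntegral_eq_integral_of_forall_compl_eq_zero fun y hy => ?_
    simp [hG, fderiv_eq_zero_of_notMem_tsupport fun h' => hy (hsub h')]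
  have hfd : ∀ z, fderiv ℝ φ z = s • fderiv ℝ φ' (x + s • z) := fun z => by
    rw [← fderiv_comp_affine, ← hφe]
  have hL : ∫ z in ball (0 : EucSp n) R,
      fderiv ℝ φ z (A (x + s • z) (gradient (fun z => g (x + s • z)) z))
      = ∫ z, s ^ 2 * G (x + s • z) := by
    rw [setIntegral_eq_integral_of_forall_compl_eq_zero]
    · refine integral_congr_ae (Eventually.of_forall fun z => ?_)
      by_cases hz : z ∈ tsupport φ
      · have hzb : x + s • z ∈ ball x (s * R) := hball _ (by rw [he']; exact hφ.2.2 hz)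
        have : gradient g (x + s • z) = gradient v (x + s • z) := by
          unfold gradient
          rw [(hg.eventuallyEq_of_mem (isOpen_ball.mem_nhds hzb)).fderiv_eq]
        simp only [hG, gradient_comp_affine, hfd z, this, map_smul,
          smul_eq_mul, _root_.smul_apply]
        ring
      · have h0 := fderiv_eq_zero_of_notMem_tsupport hz
        have h1 : fderiv ℝ φ' (x + s • z) = 0 := by
          rw [hfd z, smul_eq_zero] at h0
          exact h0.resolve_left hs.ne'
        simp [hG, h0, h1]
    · intro z hz
      simp [fderiv_eq_zero_of_notMem_tsupport fun h' => hz (hφ.2.2 h')]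
  have hR : ∫ z, |φ z| = (s ^ n)⁻¹ * ∫ y, |φ' y| := by
    rw [← integral_comp_affine (fun y => |φ' y|) x hs]
    simp [hφ', he']
  rw [hL, hR, integral_const_mul, integral_comp_affine G x hs, abs_mul, abs_mul,
    abs_of_pos (show 0 < s ^ 2 by positivity), abs_of_pos (show 0 < (s ^ n)⁻¹ by positivity)]
  rw [hGD] at h1
  calc s ^ 2 * ((s ^ n)⁻¹ * |∫ y, G y|) ≤ s ^ 2 * ((s ^ n)⁻¹ * (M * ∫ y, |φ' y|)) := by gcongr
    _ = _ := by ring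

/-- Positive semidefinite Cauchy–Schwarz: `|Aξ|² ≤ Λ⟨Aξ, ξ⟩`. -/
theorem norm_sq_apply_le {T : EucSp n →L[ℝ] EucSp n} {lam Lam : ℝ} (hlam : 0 < lam)
    (hsymm : ∀ ξ η, ⟪T ξ, η⟫ = ⟪ξ, T η⟫)
    (hell : ∀ ξ, lam * ‖ξ‖ ^ 2 ≤ ⟪T ξ, ξ⟫ ∧ ⟪T ξ, ξ⟫ ≤ Lam * ‖ξ‖ ^ 2) (ξ : EucSp n) :
    ‖T ξ‖ ^ 2 ≤ Lam * ⟪T ξ, ξ⟫ := by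
  have hpos : ∀ ζ, 0 ≤ ⟪T ζ, ζ⟫ := fun ζ => le_trans (by positivity) (hell ζ).1
  rcases eq_or_ne (T ξ) 0 with h0 | h0
  · simp [h0]
  have hN : 0 < ‖T ξ‖ ^ 2 := by positivity
  have h1 := (hell (T ξ)).1
  have h2 := (hell (T ξ)).2
  have hLam : 0 < Lam := by
    by_contra hneg
    nlinarith [mul_pos hlam hN, mul_nonneg (neg_nonneg.2 (not_lt.1 hneg)) hN.le]
  have h3 := hpos (Lam • ξ - T ξ)
  simp only [map_sub, map_smul, inner_sub_left, inner_sub_right, inner_smul_left,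
    inner_smul_right, conj_trivial] at h3
  have h4 : ⟪T (T ξ), ξ⟫ = ‖T ξ‖ ^ 2 := by
    rw [hsymm, real_inner_self_eq_norm_sq]
  rw [h4, real_inner_self_eq_norm_sq] at h3
  have h5 : 0 ≤ Lam * (Lam * ⟪T ξ, ξ⟫ - ‖T ξ‖ ^ 2) := by linarith
  linarith [nonneg_of_mul_nonneg_right h5 hLam]

theorem norm_apply_le {T : EucSp n →L[ℝ] EucSp n} {lam Lam : ℝ} (hlam : 0 < lam)
    (hLam : lam ≤ Lam) (hsymm : ∀ ξ η, ⟪T ξ, η⟫ = ⟪ξ, T η⟫)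
    (hell : ∀ ξ, lam * ‖ξ‖ ^ 2 ≤ ⟪T ξ, ξ⟫ ∧ ⟪T ξ, ξ⟫ ≤ Lam * ‖ξ‖ ^ 2) (ξ : EucSp n) :
    ‖T ξ‖ ≤ Lam * ‖ξ‖ := by
  have h1 := norm_sq_apply_le hlam hsymm hell ξ
  have h2 := (hell ξ).2
  have h0 : 0 ≤ Lam := hlam.le.trans hLam
  refine abs_le_of_sq_le_sq' ?_ (by positivity) |>.2
  nlinarith [mul_le_mul_of_nonneg_left h2 h0]

theorem norm_gradient_le_of_lipschitz {v : EucSp n → ℝ} {L : ℝ≥0} (hv : LipschitzWith L v)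
    (x : EucSp n) : ‖gradient v x‖ ≤ L := by
  simpa [gradient] using norm_fderiv_le_of_lipschitz ℝ (x₀ := x) hv

theorem measurable_gradient (v : EucSp n → ℝ) : Measurable (gradient v) :=
  (InnerProductSpace.toDual ℝ (EucSp n)).symm.continuous.measurable.comp (measurable_fderiv ℝ v)

theorem aestronglyMeasurable_flux {A : EucSp n → (EucSp n →L[ℝ] EucSp n)} {D : Set (EucSp n)}
    (hA : ContinuousOn A D) (hD : MeasurableSet D) (v : EucSp n → ℝ) :
    AEStronglyMeasurable (fun x => A x (gradient v x)) (volume.restrict D) :=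
  (ContinuousLinearMap.id ℝ (EucSp n →L[ℝ] EucSp n)).aestronglyMeasurable_comp₂
    (hA.aestronglyMeasurable hD) (measurable_gradient v).aestronglyMeasurable

theorem lipschitzWith_sub_mul_sq {v ζ : EucSp n → ℝ} {L Z : ℝ≥0} {c ω : ℝ} {S : Set (EucSp n)}
    (hv : LipschitzWith L v) (hζ : LipschitzWith Z ζ) (h0 : ∀ x, 0 ≤ ζ x) (h1 : ∀ x, ζ x ≤ 1)
    (hS : ∀ x ∉ S, ζ x = 0) (hω : 0 ≤ ω) (hvω : ∀ x ∈ S, |v x - c| ≤ ω) :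
    LipschitzWith (L + ω.toNNReal * (2 * Z)) fun x => (v x - c) * ζ x ^ 2 := by
  have key : ∀ x, ∀ y ∈ S, |(v x - c) * ζ x ^ 2 - (v y - c) * ζ y ^ 2|
      ≤ (L + ω * (2 * Z)) * dist x y := by
    intro x y hy
    have e : (v x - c) * ζ x ^ 2 - (v y - c) * ζ y ^ 2
        = (v x - v y) * ζ x ^ 2 + (v y - c) * ((ζ x - ζ y) * (ζ x + ζ y)) := by ring
    have a1 : |v x - v y| ≤ L * dist x y := hv.dist_le_mul x y
    have a2 : |ζ x - ζ y| ≤ Z * dist x y := hζ.dist_le_mul x y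
    have a3 : |ζ x + ζ y| ≤ 2 := by
      rw [abs_of_nonneg (add_nonneg (h0 x) (h0 y))]
      linarith [h1 x, h1 y]
    have a4 : |ζ x ^ 2| ≤ 1 := by
      rw [abs_of_nonneg (sq_nonneg _)]
      exact pow_le_one₀ (h0 x) (h1 x)
    rw [e]
    refine (abs_add_le _ _).trans ?_
    rw [abs_mul, abs_mul, abs_mul]
    have b1 : |v x - v y| * |ζ x ^ 2| ≤ L * dist x y * 1 := by gcongr
    have b2 : |v y - c| * (|ζ x - ζ y| * |ζ x + ζ y|) ≤ ω * (Z * dist x y * 2) := by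
      gcongr
      exact hvω y hy
    linarith
  refine LipschitzWith.of_dist_le_mul fun x y => ?_
  rw [Real.dist_eq]
  simp only [NNReal.coe_add, NNReal.coe_mul, Real.coe_toNNReal ω hω, NNReal.coe_ofNat]
  by_cases hy : y ∈ S
  · exact key x y hy
  · by_cases hx : x ∈ S
    · rw [abs_sub_comm, dist_comm]
      exact key y x hx
    · simp [hS x hx, hS y hy]
      positivity

/-- The pointwise inequality behind the Caccioppoli estimate. -/
theorem caccioppoli_pointwise {T : EucSp n →L[ℝ] EucSp n} {lam Lam : ℝ} (hlam : 0 < lam)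
    (hLam : lam ≤ Lam) (hsymm : ∀ ξ η, ⟪T ξ, η⟫ = ⟪ξ, T η⟫)
    (hell : ∀ ξ, lam * ‖ξ‖ ^ 2 ≤ ⟪T ξ, ξ⟫ ∧ ⟪T ξ, ξ⟫ ≤ Lam * ‖ξ‖ ^ 2) (ξ η : EucSp n)
    {t z ω Z : ℝ} (ht : |t| ≤ ω) (hη : ‖η‖ ≤ Z) :
    lam / 2 * (z ^ 2 * ‖ξ‖ ^ 2) - 2 * ω ^ 2 * Lam * Z ^ 2
      ≤ z ^ 2 * ⟪ξ, T ξ⟫ + 2 * t * z * ⟪η, T ξ⟫ := by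
  have h3 : 0 ≤ ⟪T (z • ξ + (2 * t) • η), z • ξ + (2 * t) • η⟫ :=
    le_trans (by positivity) (hell _).1
  have hsw : ⟪T η, ξ⟫ = ⟪η, T ξ⟫ := hsymm _ _
  have hsw2 : ⟪T ξ, η⟫ = ⟪η, T ξ⟫ := real_inner_comm _ _
  have hsw3 : ⟪T ξ, ξ⟫ = ⟪ξ, T ξ⟫ := real_inner_comm _ _
  simp only [map_add, map_smul, inner_add_left, inner_add_right, inner_smul_left,
    inner_smul_right, conj_trivial, hsw, hsw2, hsw3] at h3
  have h4 := (hell ξ).1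
  rw [hsw3] at h4
  have h5 : t ^ 2 * ⟪T η, η⟫ ≤ ω ^ 2 * (Lam * Z ^ 2) := by
    have ht2 : t ^ 2 ≤ ω ^ 2 := sq_le_sq' (abs_le.1 ht).1 (abs_le.1 ht).2
    have h0 : 0 ≤ Lam := hlam.le.trans hLam
    have h6 : ⟪T η, η⟫ ≤ Lam * Z ^ 2 := (hell η).2.trans (by gcongr)
    exact (mul_le_mul_of_nonneg_left h6 (sq_nonneg t)).trans (by gcongr)
  nlinarith [mul_le_mul_of_nonneg_left h4 (sq_nonneg z)]

/-- Caccioppoli estimate, in `L¹` form. -/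
theorem exists_caccioppoli (n : ℕ) {lam Lam : ℝ} (hlam : 0 < lam) (hLam : lam ≤ Lam) :
    ∃ C > (0 : ℝ), ∀ (A : EucSp n → (EucSp n →L[ℝ] EucSp n)) (v : EucSp n → ℝ) (L : ℝ≥0)
      (M ω c : ℝ), LipschitzWith L v → ContinuousOn A (ball 0 2) →
      IsElliptic A lam Lam (ball 0 2) → IsSymmCoeff A (ball 0 2) → 0 ≤ M → 0 < ω →
      (∀ x ∈ ball (0 : EucSp n) 2, |v x - c| ≤ ω) → WeakBdd A v M (ball 0 2) →
      ∫ x in ball (0 : EucSp n) 1, ‖gradient v x‖ ≤ C * (ω + M) := by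
  let ζ : ContDiffBump (0 : EucSp n) := ⟨1, 3 / 2, one_pos, by norm_num⟩
  have hζc : ContDiff ℝ 1 ζ := ζ.contDiff
  obtain ⟨Z, hZ⟩ := hζc.lipschitzWith_of_hasCompactSupport ζ.hasCompactSupport one_ne_zero
  have hLam0 : 0 < Lam := hlam.trans_le hLam
  set V : ℝ := volume.real (ball (0 : EucSp n) 2) with hV
  have hVpos : 0 ≤ V := measureReal_nonneg
  refine ⟨2 / lam * (V + 2 * Lam * Z ^ 2 * V) + V + 1, by positivity, ?_⟩
  intro A v L M ω c hv hA hell hsymm hM hω hvω hweak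
  set F : EucSp n → EucSp n := fun x => A x (gradient v x) with hF
  have hFm : AEStronglyMeasurable F (volume.restrict (ball 0 2)) :=
    aestronglyMeasurable_flux hA measurableSet_ball v
  have hFb : ∀ x ∈ ball (0 : EucSp n) 2, ‖F x‖ ≤ Lam * L := fun x hx =>
    (norm_apply_le hlam hLam (hsymm x hx) (hell x hx) _).trans
      (mul_le_mul_of_nonneg_left (norm_gradient_le_of_lipschitz hv x) hLam0.le)
  have hζ0 : ∀ x ∉ ball (0 : EucSp n) (3 / 2), ζ x = 0 := fun x hx => by
    rw [← ζ.support_eq] at *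
    exact Function.notMem_support.1 hx
  have hsub : ball (0 : EucSp n) (3 / 2) ⊆ ball 0 2 := ball_subset_ball (by norm_num)
  set ψ : EucSp n → ℝ := fun x => (v x - c) * ζ x ^ 2 with hψ
  have hψL := lipschitzWith_sub_mul_sq hv hZ (fun x => ζ.nonneg) (fun x => ζ.le_one) hζ0 hω.le
    (fun x hx => hvω x (hsub hx))
  have htest := lipschitz_test (ρ := 3 / 2) (by norm_num) hFm hFb hweak hψL (fun x hx => by
    rw [hζ0 x (by simp [hx.le])]; ring)
  have hψb : ∫ x, |ψ x| ≤ ω * V := by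
    have e : ∫ x, |ψ x| = ∫ x in ball 0 2, |ψ x| := by
      refine (setIntegral_eq_integral_of_forall_compl_eq_zero fun x hx => ?_).symm
      simp [hψ, hζ0 x fun h => hx (hsub h)]
    rw [e]
    refine (Real.le_norm_self _).trans (norm_setIntegral_le_of_norm_le_const
      measure_ball_lt_top fun x hx => ?_)
    rw [Real.norm_eq_abs, abs_abs, abs_mul]
    have h1 : |ζ x ^ 2| ≤ 1 := by
      rw [abs_of_nonneg (sq_nonneg _)]
      exact pow_le_one₀ ζ.nonneg ζ.le_one
    calc |v x - c| * |ζ x ^ 2| ≤ ω * 1 := by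
          gcongr
          exact hvω x hx
      _ = ω := mul_one _
  set E : EucSp n → ℝ := fun x => fderiv ℝ ψ x (F x) with hE
  have hEint : IntegrableOn E (ball 0 2) := by
    refine IntegrableOn.of_bound measure_ball_lt_top ?_
      ((L + ω.toNNReal * (2 * Z) : ℝ≥0) * (Lam * L)) ?_
    · exact (ContinuousLinearMap.id ℝ (EucSp n →L[ℝ] ℝ)).aestronglyMeasurable_comp₂
        (measurable_fderiv ℝ ψ).aestronglyMeasurable hFm
    · refine (ae_restrict_iff' measurableSet_ball).2 (Eventually.of_forall fun x hx => ?_)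
      refine (ContinuousLinearMap.le_opNorm _ _).trans ?_
      gcongr
      · exact norm_fderiv_le_of_lipschitz ℝ hψL
      · exact hFb x hx
  set a : ℝ := ω + M with ha
  have hapos : 0 < a := by positivity
  have hpt : ∀ᵐ x ∂volume.restrict (ball (0 : EucSp n) 2),
      (ball (0 : EucSp n) 1).indicator (fun x => ‖gradient v x‖) x
        ≤ a⁻¹ * (2 / lam) * (E x + 2 * ω ^ 2 * Lam * Z ^ 2) + a := by
    refine (ae_restrict_iff' measurableSet_ball).2 ?_
    filter_upwards [hv.ae_differentiableAt] with x hdx hx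
    have hζd : DifferentiableAt ℝ ζ x := hζc.differentiable one_ne_zero x
    have hEx : E x = ζ x ^ 2 * ⟪gradient v x, A x (gradient v x)⟫
        + 2 * (v x - c) * ζ x * ⟪gradient ζ x, A x (gradient v x)⟫ := by
      have h1 : HasFDerivAt ψ ((v x - c) • ((2 * ζ x) • fderiv ℝ ζ x)
          + (ζ x ^ 2) • fderiv ℝ v x) x := by
        have h : HasFDerivAt ψ _ x := (hdx.hasFDerivAt.sub_const c).mul (hζd.hasFDerivAt.pow 2)
        refine h.congr_fderiv ?_
        simp
      simp only [hE, h1.fderiv, inner_gradient_left, hF]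
      simp
      ring
    have hgz : ‖gradient ζ x‖ ≤ Z := norm_gradient_le_of_lipschitz hZ x
    have h2 := caccioppoli_pointwise hlam hLam (hsymm x hx) (hell x hx) (gradient v x)
      (gradient ζ x) (z := ζ x) (hvω x hx) hgz
    rw [← hEx] at h2
    set q := ‖gradient v x‖ with hq
    have h3 : 0 ≤ a⁻¹ * (2 / lam) * (lam / 2 * (ζ x ^ 2 * q ^ 2)) := by positivity
    have h4 : a⁻¹ * (2 / lam) * (lam / 2 * (ζ x ^ 2 * q ^ 2))
        ≤ a⁻¹ * (2 / lam) * (E x + 2 * ω ^ 2 * Lam * Z ^ 2) := by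
      gcongr
      linarith
    by_cases hx1 : x ∈ ball (0 : EucSp n) 1
    · have hz1 : ζ x = 1 := ζ.one_of_mem_closedBall (ball_subset_closedBall hx1)
      rw [indicator_of_mem hx1]
      have h5 : a⁻¹ * (2 / lam) * (lam / 2 * (ζ x ^ 2 * q ^ 2)) = a⁻¹ * q ^ 2 := by
        rw [hz1]
        field_simp
      have h6 : q ≤ a⁻¹ * q ^ 2 + a := by
        have : a⁻¹ * q ^ 2 + a - q = a⁻¹ * ((q - a) ^ 2 + a * q) := by
          field_simp
          ring
        have h7 : 0 ≤ a⁻¹ * ((q - a) ^ 2 + a * q) := by positivity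
        linarith
      linarith
    · rw [indicator_of_notMem hx1]
      linarith
  have hgint : IntegrableOn (fun x => (ball (0 : EucSp n) 1).indicator
      (fun x => ‖gradient v x‖) x) (ball 0 2) := by
    refine IntegrableOn.of_bound measure_ball_lt_top ?_ L (Eventually.of_forall fun x => ?_)
    · exact ((measurable_gradient v).norm.indicator measurableSet_ball).aestronglyMeasurable
    · rw [norm_indicator_eq_indicator_norm]
      exact (indicator_le_self' (fun x _ => norm_nonneg _) x).trans
        (by simpa using norm_gradient_le_of_lipschitz hv x)
  have hcst : ∀ b : ℝ, IntegrableOn (fun _ : EucSp n => b) (ball 0 2) := fun b =>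
    integrableOn_const measure_ball_lt_top.ne
  have hEint2 : IntegrableOn (fun x => E x + 2 * ω ^ 2 * Lam * Z ^ 2) (ball 0 2) :=
    hEint.add (hcst _)
  have hEint3 : IntegrableOn (fun x => a⁻¹ * (2 / lam) * (E x + 2 * ω ^ 2 * Lam * Z ^ 2))
      (ball 0 2) := hEint2.const_mul _
  have hmono := integral_mono_ae hgint (hEint3.add (hcst a)) hpt
  rw [setIntegral_indicator measurableSet_ball,
    inter_eq_right.2 (ball_subset_ball (by norm_num))] at hmono
  simp only [Pi.add_apply] at hmono
  rw [integral_add hEint3 (hcst a), integral_const_mul,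
    integral_add hEint (hcst _), setIntegral_const, setIntegral_const, smul_eq_mul, smul_eq_mul,
    ← hV] at hmono
  refine hmono.trans ?_
  have h1 : ∫ x in ball 0 2, E x ≤ a * a * V := by
    refine (le_abs_self _).trans (htest.trans ?_)
    calc M * ∫ x, |ψ x| ≤ M * (ω * V) := by gcongr
      _ ≤ a * (a * V) := by
          gcongr <;> linarith
      _ = _ := by ring
  have h2 : V * (2 * ω ^ 2 * Lam * Z ^ 2) ≤ V * (2 * a ^ 2 * Lam * Z ^ 2) := by
    gcongr
    linarith
  calc a⁻¹ * (2 / lam) * ((∫ x in ball 0 2, E x) + V * (2 * ω ^ 2 * Lam * Z ^ 2)) + V * a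
      ≤ a⁻¹ * (2 / lam) * (a * a * V + V * (2 * a ^ 2 * Lam * Z ^ 2)) + V * a := by
        have h3 := add_le_add h1 h2
        gcongr
    _ = (2 / lam * (V + 2 * Lam * Z ^ 2 * V) + V) * a := by
        field_simp
    _ ≤ (2 / lam * (V + 2 * Lam * Z ^ 2 * V) + V + 1) * a :=
        mul_le_mul_of_nonneg_right (by linarith) hapos.le

theorem hasDerivAt_max_zero_sq (t : ℝ) :
    HasDerivAt (fun t : ℝ => max t 0 ^ 2) (2 * max t 0) t := by
  rcases lt_trichotomy t 0 with h | h | h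
  · rw [max_eq_right h.le, mul_zero]
    refine (hasDerivAt_const t (0 : ℝ)).congr_of_eventuallyEq ?_
    filter_upwards [Iio_mem_nhds h] with u hu
    rw [max_eq_right hu.le]
    norm_num
  · subst h
    rw [max_self, mul_zero]
    refine HasDerivAt.of_isLittleO ?_
    have h1 : (fun u : ℝ => u ^ 2) =o[𝓝 0] fun u => u := by
      simpa using Asymptotics.isLittleO_pow_id (𝕜 := ℝ) (n := 2) (by norm_num)
    refine (Asymptotics.IsBigO.of_bound 1 (Eventually.of_forall fun u => ?_)).trans_isLittleO
      (h1.trans_eventuallyEq ?_)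
    · simp only [max_self, smul_zero, sub_zero, one_mul, norm_pow]
      rw [zero_pow two_ne_zero, sub_zero, norm_pow]
      gcongr
      rw [Real.norm_eq_abs, Real.norm_eq_abs, abs_of_nonneg (le_max_right _ _)]
      exact max_le (le_abs_self u) (abs_nonneg u)
    · exact Eventually.of_forall fun u => by simp
  · rw [max_eq_left h.le]
    have h1 : HasDerivAt (fun u : ℝ => u ^ 2) (2 * t) t := by simpa using hasDerivAt_pow 2 t
    refine h1.congr_of_eventuallyEq ?_
    filter_upwards [Ioi_mem_nhds h] with u hu
    rw [max_eq_left (le_of_lt hu)]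

/-- Symmetry and ellipticity of a single matrix. -/
def IsEllMap (T : EucSp n →L[ℝ] EucSp n) (lam Lam : ℝ) : Prop :=
  0 < lam ∧ lam ≤ Lam ∧ (∀ ξ η, ⟪T ξ, η⟫ = ⟪ξ, T η⟫) ∧
    ∀ ξ, lam * ‖ξ‖ ^ 2 ≤ ⟪T ξ, ξ⟫ ∧ ⟪T ξ, ξ⟫ ≤ Lam * ‖ξ‖ ^ 2

namespace IsEllMap

variable {T : EucSp n →L[ℝ] EucSp n} {lam Lam : ℝ}

theorem injective (hT : IsEllMap T lam Lam) : Function.Injective T := by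
  refine (injective_iff_map_eq_zero T).2 fun ξ hξ => ?_
  have h := (hT.2.2.2 ξ).1
  rw [hξ, inner_zero_left] at h
  have h2 : ‖ξ‖ ^ 2 ≤ 0 := nonpos_of_mul_nonpos_right h hT.1
  simpa using le_antisymm h2 (sq_nonneg _)

theorem isInvertible (hT : IsEllMap T lam Lam) : T.IsInvertible :=
  ⟨(LinearEquiv.ofInjectiveEndo (T : EucSp n →ₗ[ℝ] EucSp n)
    hT.injective).toContinuousLinearEquiv, by ext; simp⟩

theorem apply_inverse (hT : IsEllMap T lam Lam) (z : EucSp n) : T (T.inverse z) = z := by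
  obtain ⟨e, rfl⟩ := hT.isInvertible
  simp

theorem inner_inverse_comm (hT : IsEllMap T lam Lam) (z w : EucSp n) :
    ⟪T.inverse z, w⟫ = ⟪z, T.inverse w⟫ := by
  have h := hT.2.2.1 (T.inverse z) (T.inverse w)
  rw [hT.apply_inverse, hT.apply_inverse] at h
  exact h.symm

theorem norm_inverse_le (hT : IsEllMap T lam Lam) (z : EucSp n) :
    ‖T.inverse z‖ ≤ ‖z‖ / lam := by
  have h := (hT.2.2.2 (T.inverse z)).1
  rw [hT.apply_inverse] at h
  have h2 := h.trans (real_inner_le_norm _ _)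
  rw [le_div_iff₀ hT.1]
  rcases (norm_nonneg (T.inverse z)).eq_or_lt with h0 | h0
  · rw [← h0, zero_mul]
    exact norm_nonneg _
  · refine le_of_mul_le_mul_right ?_ h0
    linarith [h2]

theorem sq_norm_le (hT : IsEllMap T lam Lam) (z : EucSp n) :
    ‖z‖ ^ 2 ≤ Lam * ⟪T.inverse z, z⟫ := by
  have h := norm_sq_apply_le hT.1 hT.2.2.1 hT.2.2.2 (T.inverse z)
  rwa [hT.apply_inverse, real_inner_comm] at h

theorem le_sq_norm (hT : IsEllMap T lam Lam) (z : EucSp n) :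
    Lam * ⟪T.inverse z, z⟫ ≤ Lam / lam * ‖z‖ ^ 2 := by
  have h0 : 0 ≤ Lam := hT.1.le.trans hT.2.1
  have h1 : ⟪T.inverse z, z⟫ ≤ ‖z‖ / lam * ‖z‖ :=
    (real_inner_le_norm _ _).trans (by gcongr; exact hT.norm_inverse_le z)
  calc Lam * ⟪T.inverse z, z⟫ ≤ Lam * (‖z‖ / lam * ‖z‖) := by gcongr
    _ = _ := by ring

end IsEllMap

/-- The paraboloid bump `(1 - Λ⟨T⁻¹z, z⟩)⁺` adapted to the matrix `T`. -/
def ellBump (T : EucSp n →L[ℝ] EucSp n) (Lam : ℝ) (z : EucSp n) : ℝ :=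
  max (1 - Lam * ⟪T.inverse z, z⟫) 0

theorem ellBump_nonneg (T : EucSp n →L[ℝ] EucSp n) (Lam : ℝ) (z : EucSp n) :
    0 ≤ ellBump T Lam z := le_max_right _ _

theorem continuous_ellBump (T : EucSp n →L[ℝ] EucSp n) (Lam : ℝ) :
    Continuous (ellBump T Lam) := by
  unfold ellBump
  fun_prop

theorem ellBump_neg (T : EucSp n →L[ℝ] EucSp n) (Lam : ℝ) (z : EucSp n) :
    ellBump T Lam (-z) = ellBump T Lam z := by
  simp [ellBump]

namespace IsEllMap

variable {T : EucSp n →L[ℝ] EucSp n} {lam Lam : ℝ}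

theorem ellBump_le_one (hT : IsEllMap T lam Lam) (z : EucSp n) : ellBump T Lam z ≤ 1 := by
  have h := hT.sq_norm_le z
  exact max_le (by nlinarith [sq_nonneg ‖z‖]) zero_le_one

theorem ellBump_eq_zero (hT : IsEllMap T lam Lam) {z : EucSp n} (hz : 1 ≤ ‖z‖) :
    ellBump T Lam z = 0 := by
  have h := hT.sq_norm_le z
  exact max_eq_right (by nlinarith)

theorem half_le_ellBump (hT : IsEllMap T lam Lam) {z : EucSp n}
    (hz : ‖z‖ ^ 2 ≤ lam / (2 * Lam)) : 1 / 2 ≤ ellBump T Lam z := by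
  have h := hT.le_sq_norm z
  have h0 : 0 < Lam := hT.1.trans_le hT.2.1
  have h1 : Lam / lam * ‖z‖ ^ 2 ≤ Lam / lam * (lam / (2 * Lam)) :=
    mul_le_mul_of_nonneg_left hz (div_nonneg h0.le hT.1.le)
  have h2 : Lam / lam * (lam / (2 * Lam)) = 1 / 2 := by
    have := hT.1.ne'
    field_simp
  exact le_max_of_le_left (by linarith)

theorem hasFDerivAt_ellBump_sq (hT : IsEllMap T lam Lam) (z : EucSp n) :
    HasFDerivAt (fun z => ellBump T Lam z ^ 2)
      ((-4 * Lam * ellBump T Lam z) • innerSL ℝ (T.inverse z)) z := by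
  have h1 : HasFDerivAt (fun z : EucSp n => 1 - Lam * ⟪T.inverse z, z⟫)
      ((-2 * Lam) • innerSL ℝ (T.inverse z)) z := by
    have h : HasFDerivAt (fun z : EucSp n => 1 - Lam * ⟪T.inverse z, z⟫) _ z :=
      (((T.inverse.hasFDerivAt (x := z)).inner ℝ (hasFDerivAt_id z)).const_mul Lam).const_sub 1
    refine h.congr_fderiv ?_
    ext w
    have := hT.inner_inverse_comm z w
    have h3 : ⟪T.inverse w, z⟫ = ⟪T.inverse z, w⟫ := by
      rw [hT.inner_inverse_comm, real_inner_comm]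
    simp [h3]
    ring
  refine ((hasDerivAt_max_zero_sq _).comp_hasFDerivAt z h1).congr_fderiv ?_
  rw [smul_smul]
  congr 1
  unfold ellBump
  ring

theorem hasCompactSupport_ellBump (hT : IsEllMap T lam Lam) :
    HasCompactSupport (ellBump T Lam) :=
  HasCompactSupport.intro (isCompact_closedBall (0 : EucSp n) 1) fun z hz =>
    hT.ellBump_eq_zero (by simpa using (not_le.1 (by simpa using hz)).le)

theorem integrable_ellBump (hT : IsEllMap T lam Lam) : Integrable (ellBump T Lam) :=
  (continuous_ellBump T Lam).integrable_of_hasCompactSupport hT.hasCompactSupport_ellBump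

theorem le_integral_ellBump (hT : IsEllMap T lam Lam) :
    1 / 2 * volume.real (ball (0 : EucSp n) √(lam / (2 * Lam))) ≤ ∫ z, ellBump T Lam z := by
  refine le_trans ?_ (setIntegral_le_integral (s := ball (0 : EucSp n) √(lam / (2 * Lam)))
    hT.integrable_ellBump (Eventually.of_forall (ellBump_nonneg T Lam)))
  have h0 : 0 < Lam := hT.1.trans_le hT.2.1
  have h1 := setIntegral_mono_on (μ := volume) (f := fun _ : EucSp n => (1 / 2 : ℝ))
    (s := ball (0 : EucSp n) √(lam / (2 * Lam))) (integrableOn_const measure_ball_lt_top.ne)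
    hT.integrable_ellBump.integrableOn measurableSet_ball fun z hz => hT.half_le_ellBump (by
      have h2 : ‖z‖ ≤ √(lam / (2 * Lam)) := (mem_ball_zero_iff.1 hz).le
      have h3 : 0 ≤ lam / (2 * Lam) := div_nonneg hT.1.le (by positivity)
      calc ‖z‖ ^ 2 ≤ √(lam / (2 * Lam)) ^ 2 := by gcongr
        _ = _ := Real.sq_sqrt h3)
  rwa [setIntegral_const, smul_eq_mul, mul_comm] at h1

theorem integral_ellBump_pos (hT : IsEllMap T lam Lam) : 0 < ∫ z, ellBump T Lam z := by
  have h0 : 0 < Lam := hT.1.trans_le hT.2.1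
  have h1 : 0 < √(lam / (2 * Lam)) := Real.sqrt_pos.2 (div_pos hT.1 (by positivity))
  refine lt_of_lt_of_le (mul_pos (by norm_num) ?_) hT.le_integral_ellBump
  exact ENNReal.toReal_pos (measure_ball_pos volume _ h1).ne' measure_ball_lt_top.ne

theorem integral_ellBump_le (hT : IsEllMap T lam Lam) :
    ∫ z, ellBump T Lam z ≤ volume.real (ball (0 : EucSp n) 1) := by
  rw [← setIntegral_eq_integral_of_forall_compl_eq_zero (s := ball (0 : EucSp n) 1)
    fun z hz => hT.ellBump_eq_zero (by simpa using hz)]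
  have h1 := setIntegral_mono_on (μ := volume) (g := fun _ : EucSp n => (1 : ℝ))
    (s := ball (0 : EucSp n) 1) hT.integrable_ellBump.integrableOn
    (integrableOn_const measure_ball_lt_top.ne) measurableSet_ball fun z _ => hT.ellBump_le_one z
  rwa [setIntegral_const, smul_eq_mul, mul_one] at h1

theorem norm_fderiv_ellBump_sq_le (hT : IsEllMap T lam Lam) (z : EucSp n) :
    ‖fderiv ℝ (fun z => ellBump T Lam z ^ 2) z‖ ≤ 4 * Lam / lam := by
  have h0 : 0 < Lam := hT.1.trans_le hT.2.1
  have h2 := hT.1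
  rw [(hT.hasFDerivAt_ellBump_sq z).fderiv, norm_smul, innerSL_apply_norm, norm_mul, norm_mul,
    Real.norm_of_nonneg h0.le, Real.norm_of_nonneg (ellBump_nonneg T Lam z)]
  norm_num
  rcases le_or_gt 1 ‖z‖ with hz | hz
  · rw [hT.ellBump_eq_zero hz]
    simp
    positivity
  · have h1 : ‖T.inverse z‖ ≤ 1 / lam :=
      (hT.norm_inverse_le z).trans (div_le_div_of_nonneg_right hz.le h2.le)
    calc 4 * Lam * ellBump T Lam z * ‖T.inverse z‖ ≤ 4 * Lam * 1 * (1 / lam) := by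
          gcongr
          exact hT.ellBump_le_one z
      _ = _ := by ring

end IsEllMap

theorem IsEllMap.of {A : EucSp n → (EucSp n →L[ℝ] EucSp n)} {lam Lam : ℝ} {D : Set (EucSp n)}
    (hlam : 0 < lam) (hLam : lam ≤ Lam) (hell : IsElliptic A lam Lam D) (hsymm : IsSymmCoeff A D)
    {x : EucSp n} (hx : x ∈ D) : IsEllMap (A x) lam Lam :=
  ⟨hlam, hLam, hsymm x hx, hell x hx⟩

/-- The weighted radial derivative of a solution is controlled by the oscillation of `A`. -/
theorem exists_radial_bound (n : ℕ) {lam Lam : ℝ} (hlam : 0 < lam) (hLam : lam ≤ Lam) :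
    ∃ C > (0 : ℝ), ∀ (A : EucSp n → (EucSp n →L[ℝ] EucSp n)) (v : EucSp n → ℝ) (L : ℝ≥0)
      (M ω c δ : ℝ), LipschitzWith L v → ContinuousOn A (ball 0 2) →
      IsElliptic A lam Lam (ball 0 2) → IsSymmCoeff A (ball 0 2) → 0 ≤ M → 0 < ω → 0 ≤ δ →
      (∀ x ∈ ball (0 : EucSp n) 2, |v x - c| ≤ ω) →
      (∀ x ∈ ball (0 : EucSp n) 1, ‖A x - A 0‖ ≤ δ) → WeakBdd A v M (ball 0 2) →
      |∫ z, ⟪gradient v z, z⟫ * ellBump (A 0) Lam z| ≤ C * (δ * (ω + M) + M) := by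
  obtain ⟨C₀, hC₀, hcac⟩ := exists_caccioppoli n hlam hLam
  have hLam0 : 0 < Lam := hlam.trans_le hLam
  set V : ℝ := volume.real (ball (0 : EucSp n) 1) with hV
  have hVpos : 0 ≤ V := measureReal_nonneg
  refine ⟨(1 / lam) * C₀ + 1 / (4 * Lam) * V, by positivity, ?_⟩
  intro A v L M ω c δ hv hA hell hsymm hM hω hδ hvω hAδ hweak
  have h02 : (0 : EucSp n) ∈ ball (0 : EucSp n) 2 := mem_ball_self two_pos
  have hT : IsEllMap (A 0) lam Lam := IsEllMap.of hlam hLam hell hsymm h02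
  set T := A 0 with hTdef
  set G := ellBump T Lam with hG
  set F : EucSp n → EucSp n := fun x => A x (gradient v x) with hF
  have hFm : AEStronglyMeasurable F (volume.restrict (ball 0 2)) :=
    aestronglyMeasurable_flux hA measurableSet_ball v
  have hFb : ∀ x ∈ ball (0 : EucSp n) 2, ‖F x‖ ≤ Lam * L := fun x hx =>
    (norm_apply_le hlam hLam (hsymm x hx) (hell x hx) _).trans
      (mul_le_mul_of_nonneg_left (norm_gradient_le_of_lipschitz hv x) hLam0.le)
  set φ : EucSp n → ℝ := fun z => G z ^ 2 with hφ
  have hφd : ∀ z, HasFDerivAt φ ((-4 * Lam * G z) • innerSL ℝ (T.inverse z)) z :=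
    hT.hasFDerivAt_ellBump_sq
  have hφL : LipschitzWith (4 * Lam / lam).toNNReal φ := by
    refine lipschitzWith_of_nnnorm_fderiv_le (fun z => (hφd z).differentiableAt) fun z => ?_
    rw [← NNReal.coe_le_coe, coe_nnnorm, Real.coe_toNNReal _ (by positivity)]
    exact hT.norm_fderiv_ellBump_sq_le z
  have htest := lipschitz_test (ρ := 1) (by norm_num) hFm hFb hweak hφL (fun x hx => by
    simp [hφ, hG, hT.ellBump_eq_zero hx.le])
  have hφb : ∫ x, |φ x| ≤ V := by
    refine le_trans ?_ hT.integral_ellBump_le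
    refine integral_mono ?_ hT.integrable_ellBump fun z => ?_
    · refine Continuous.integrable_of_hasCompactSupport ?_ ?_
      · exact ((continuous_ellBump T Lam).pow 2).abs
      · exact hT.hasCompactSupport_ellBump.comp_left (g := fun t : ℝ => |t ^ 2|) (by simp)
    · simp only [hφ]
      rw [abs_of_nonneg (sq_nonneg _), sq]
      exact mul_le_of_le_one_left (ellBump_nonneg T Lam z) (hT.ellBump_le_one z)
  set E : EucSp n → ℝ := fun z => fderiv ℝ φ z (F z) with hE
  set P : EucSp n → ℝ := fun z => G z * ⟪T.inverse z, F z - T (gradient v z)⟫ with hP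
  have hbd : ∀ z, ‖G z • T.inverse z‖ ≤ 1 / lam := fun z => by
    rw [norm_smul, Real.norm_of_nonneg (ellBump_nonneg T Lam z)]
    rcases le_or_gt 1 ‖z‖ with hz | hz
    · rw [hT.ellBump_eq_zero hz]
      simp [hlam.le]
    · have h1 : ‖T.inverse z‖ ≤ 1 / lam :=
        (hT.norm_inverse_le z).trans (div_le_div_of_nonneg_right hz.le hlam.le)
      calc G z * ‖T.inverse z‖ ≤ 1 * (1 / lam) := by
            gcongr
            exact hT.ellBump_le_one z
        _ = _ := one_mul _
  have hGm : Continuous fun z : EucSp n => G z • T.inverse z :=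
    (continuous_ellBump T Lam).smul T.inverse.continuous
  have hEint : IntegrableOn E (ball 0 2) := by
    refine IntegrableOn.of_bound measure_ball_lt_top ?_ (4 * Lam / lam * (Lam * L)) ?_
    · exact (ContinuousLinearMap.id ℝ (EucSp n →L[ℝ] ℝ)).aestronglyMeasurable_comp₂
        (measurable_fderiv ℝ φ).aestronglyMeasurable hFm
    · refine (ae_restrict_iff' measurableSet_ball).2 (Eventually.of_forall fun x hx => ?_)
      refine (ContinuousLinearMap.le_opNorm _ _).trans ?_
      gcongr
      · exact hT.norm_fderiv_ellBump_sq_le x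
      · exact hFb x hx
  have hTg : Measurable fun z => T (gradient v z) :=
    T.continuous.measurable.comp (measurable_gradient v)
  have hPeq : ∀ z, P z = ⟪G z • T.inverse z, F z - T (gradient v z)⟫ := fun z => by
    rw [real_inner_smul_left]
  have hPint : IntegrableOn P (ball 0 2) := by
    refine IntegrableOn.of_bound measure_ball_lt_top ?_ (1 / lam * (Lam * L + ‖T‖ * L)) ?_
    · simp only [funext hPeq]
      exact hGm.aestronglyMeasurable.inner (hFm.sub hTg.aestronglyMeasurable)
    · refine (ae_restrict_iff' measurableSet_ball).2 (Eventually.of_forall fun x hx => ?_)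
      rw [hPeq]
      refine (norm_inner_le_norm _ _).trans ?_
      gcongr
      · exact hbd x
      · refine (norm_sub_le _ _).trans (add_le_add (hFb x hx) ((T.le_opNorm _).trans ?_))
        gcongr
        exact norm_gradient_le_of_lipschitz hv x
  have hid : ∀ z, ⟪gradient v z, z⟫ * G z = -(1 / (4 * Lam)) * E z - P z := fun z => by
    have h1 : E z = -4 * Lam * G z * ⟪T.inverse z, F z⟫ := by
      simp [hE, (hφd z).fderiv]
    have h2 : ⟪T.inverse z, T (gradient v z)⟫ = ⟪gradient v z, z⟫ := by
      rw [← hT.2.2.1, hT.apply_inverse, real_inner_comm]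
    have h3 : P z = G z * (⟪T.inverse z, F z⟫ - ⟪gradient v z, z⟫) := by
      simp only [hP, inner_sub_right, h2]
    rw [h1, h3]
    field_simp
    ring
  have hPb : ‖∫ z in ball (0 : EucSp n) 2, P z‖ ≤ 1 / lam * δ * (C₀ * (ω + M)) := by
    have e : ∫ z in ball (0 : EucSp n) 2, P z = ∫ z in ball (0 : EucSp n) 1, P z := by
      refine setIntegral_eq_of_subset_of_forall_sdiff_eq_zero measurableSet_ball
        (ball_subset_ball (by norm_num)) fun z hz => ?_
      simp [hP, hG, hT.ellBump_eq_zero (show 1 ≤ ‖z‖ by simpa using hz.2)]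
    rw [e]
    have hgi : IntegrableOn (fun z => ‖gradient v z‖) (ball 0 1) := by
      refine IntegrableOn.of_bound measure_ball_lt_top
        (measurable_gradient v).norm.aestronglyMeasurable L (Eventually.of_forall fun x => ?_)
      simpa using norm_gradient_le_of_lipschitz hv x
    have h1 : ‖∫ z in ball (0 : EucSp n) 1, P z‖
        ≤ ∫ z in ball (0 : EucSp n) 1, 1 / lam * δ * ‖gradient v z‖ := by
      refine norm_integral_le_of_norm_le (hgi.const_mul _)
        ((ae_restrict_iff' measurableSet_ball).2 (Eventually.of_forall fun z hz => ?_))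
      rw [hPeq]
      refine (norm_inner_le_norm _ _).trans ?_
      have h2 : F z - T (gradient v z) = (A z - T) (gradient v z) := by simp [hF]
      rw [h2, mul_assoc]
      gcongr
      · exact hbd z
      · exact ((A z - T).le_opNorm _).trans (by gcongr; exact hAδ z hz)
    rw [integral_const_mul] at h1
    refine h1.trans ?_
    gcongr
    exact hcac A v L M ω c hv hA hell hsymm hM hω hvω hweak
  have hfin : ∫ z, ⟪gradient v z, z⟫ * G z
      = -(1 / (4 * Lam)) * (∫ z in ball (0 : EucSp n) 2, E z)
        - ∫ z in ball (0 : EucSp n) 2, P z := by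
    rw [← setIntegral_eq_integral_of_forall_compl_eq_zero (s := ball (0 : EucSp n) 2)]
    · rw [← integral_const_mul, ← integral_sub (hEint.const_mul _) hPint]
      simp only [hid]
    · intro z hz
      have : 1 ≤ ‖z‖ := by
        have : 2 ≤ ‖z‖ := by simpa using hz
        linarith
      rw [hG, hT.ellBump_eq_zero this, mul_zero]
  rw [hfin]
  refine (abs_sub _ _).trans ?_
  rw [abs_mul, abs_neg, abs_of_pos (show 0 < 1 / (4 * Lam) by positivity)]
  have h1 : |∫ z in ball (0 : EucSp n) 2, E z| ≤ M * V :=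
    htest.trans (mul_le_mul_of_nonneg_left hφb hM)
  rw [Real.norm_eq_abs] at hPb
  calc 1 / (4 * Lam) * |∫ z in ball (0 : EucSp n) 2, E z| + |∫ z in ball (0 : EucSp n) 2, P z|
      ≤ 1 / (4 * Lam) * (M * V) + 1 / lam * δ * (C₀ * (ω + M)) := by gcongr
    _ ≤ 1 / (4 * Lam) * (M * V) + 1 / lam * δ * (C₀ * (ω + M))
        + ((1 / lam) * C₀ * M + 1 / (4 * Lam) * V * (δ * (ω + M))) := by
        refine le_add_of_nonneg_right ?_
        positivity
    _ = _ := by ring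

/-- The normalized elliptic bump. -/
def ellKer (T : EucSp n →L[ℝ] EucSp n) (Lam : ℝ) (z : EucSp n) : ℝ :=
  (∫ z, ellBump T Lam z)⁻¹ * ellBump T Lam z

theorem continuous_ellKer (T : EucSp n →L[ℝ] EucSp n) (Lam : ℝ) : Continuous (ellKer T Lam) :=
  continuous_const.mul (continuous_ellBump T Lam)

theorem ellKer_nonneg (T : EucSp n →L[ℝ] EucSp n) (Lam : ℝ) (z : EucSp n) :
    0 ≤ ellKer T Lam z :=
  mul_nonneg (inv_nonneg.2 (integral_nonneg (ellBump_nonneg T Lam))) (ellBump_nonneg T Lam z)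

theorem ellKer_neg (T : EucSp n →L[ℝ] EucSp n) (Lam : ℝ) (z : EucSp n) :
    ellKer T Lam (-z) = ellKer T Lam z := by
  simp [ellKer, ellBump_neg]

namespace IsEllMap

variable {T : EucSp n →L[ℝ] EucSp n} {lam Lam : ℝ}

theorem ellKer_eq_zero (hT : IsEllMap T lam Lam) {z : EucSp n} (hz : 1 ≤ ‖z‖) :
    ellKer T Lam z = 0 := by
  rw [ellKer, hT.ellBump_eq_zero hz, mul_zero]

theorem integrable_ellKer (hT : IsEllMap T lam Lam) : Integrable (ellKer T Lam) :=
  hT.integrable_ellBump.const_mul _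

theorem integral_ellKer (hT : IsEllMap T lam Lam) : ∫ z, ellKer T Lam z = 1 := by
  simp only [ellKer]
  rw [integral_const_mul, inv_mul_cancel₀ hT.integral_ellBump_pos.ne']

theorem integrable_mul_ellKer (hT : IsEllMap T lam Lam) {u : EucSp n → ℝ}
    (hu : ContinuousOn u (closedBall 0 1)) : Integrable fun z => u z * ellKer T Lam z := by
  rw [← integrableOn_iff_integrable_of_support_subset (s := closedBall (0 : EucSp n) 1)]
  · exact (hu.mul (continuous_ellKer T Lam).continuousOn).integrableOn_compact
      (isCompact_closedBall _ _)
  · refine Function.support_subset_iff'.2 fun z hz => ?_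
    rw [hT.ellKer_eq_zero (not_le.1 (by simpa using hz)).le, mul_zero]

end IsEllMap

theorem hasDerivAt_integral_comp_affine {g : EucSp n → ℝ} {L : ℝ≥0} (hg : LipschitzWith L g)
    {k : EucSp n → ℝ} (hk : Continuous k) (hk0 : ∀ z, 0 ≤ k z) (hk1 : ∀ z, 1 ≤ ‖z‖ → k z = 0)
    (x : EucSp n) {t : ℝ} (ht : 0 < t) :
    HasDerivAt (fun τ : ℝ => ∫ z, g (x + τ • z) * k z)
      (∫ z, t⁻¹ * ⟪gradient (fun z => g (x + t • z)) z, z⟫ * k z) t := by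
  have hcs : HasCompactSupport k :=
    HasCompactSupport.intro (isCompact_closedBall (0 : EucSp n) 1) fun z hz =>
      hk1 z (by simpa using (not_le.1 (by simpa using hz)).le)
  have hki : Integrable k := hk.integrable_of_hasCompactSupport hcs
  have hgc := hg.continuous
  have hgt : LipschitzWith (L * ‖t‖₊) (fun z => g (x + t • z)) := by
    refine LipschitzWith.of_dist_le_mul fun z w => ?_
    refine (hg.dist_le_mul _ _).trans_eq ?_
    rw [dist_add_left, dist_smul₀, NNReal.coe_mul, coe_nnnorm]
    ring
  refine (hasDerivAt_integral_of_dominated_loc_of_lip (bound := fun z => L * k z)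
    (s := univ) univ_mem ?_ ?_ ?_ ?_ (hki.const_mul _) ?_).2
  · exact Eventually.of_forall fun τ => by fun_prop
  · exact Continuous.integrable_of_hasCompactSupport (by fun_prop) hcs.mul_left
  · refine AEStronglyMeasurable.mul ?_ hk.aestronglyMeasurable
    exact (((measurable_gradient _).inner measurable_id).const_mul _).aestronglyMeasurable
  · refine Eventually.of_forall fun z => LipschitzWith.lipschitzOnWith ?_
    refine LipschitzWith.of_dist_le_mul fun τ σ => ?_
    have h0 : 0 ≤ L * k z := mul_nonneg L.coe_nonneg (hk0 z)
    rw [Real.coe_nnabs, abs_of_nonneg h0, Real.dist_eq, ← sub_mul, abs_mul, abs_of_nonneg (hk0 z)]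
    rcases le_or_gt 1 ‖z‖ with hz | hz
    · simp [hk1 z hz]
    · have h1 : |g (x + τ • z) - g (x + σ • z)| ≤ L * (dist τ σ * ‖z‖) := by
        refine (hg.dist_le_mul _ _).trans_eq ?_
        rw [dist_add_left, dist_eq_norm, ← sub_smul, norm_smul, Real.dist_eq, Real.norm_eq_abs]
      have h2 : dist τ σ * ‖z‖ ≤ dist τ σ * 1 := by gcongr
      calc |g (x + τ • z) - g (x + σ • z)| * k z ≤ L * (dist τ σ * 1) * k z := by
            have := hk0 z
            gcongr
            exact h1.trans (by gcongr)
        _ = _ := by ring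
  · filter_upwards [hgt.ae_differentiableAt] with z hz
    refine HasDerivAt.mul_const ?_ _
    have h1 : HasDerivAt (fun τ : ℝ => (τ * t⁻¹) • z) (t⁻¹ • z) t := by
      have := ((hasDerivAt_id t).mul_const t⁻¹).smul_const z
      simpa using this
    have h2 : HasFDerivAt (fun z => g (x + t • z)) (fderiv ℝ (fun z => g (x + t • z)) z)
        ((t * t⁻¹) • z) := by
      rw [mul_inv_cancel₀ ht.ne', one_smul]
      exact hz.hasFDerivAt
    have h3 := h2.comp_hasDerivAt t h1
    have h4 : ((fun z => g (x + t • z)) ∘ fun τ : ℝ => (τ * t⁻¹) • z)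
        = fun τ : ℝ => g (x + τ • z) := by
      funext τ
      simp only [Function.comp, smul_smul]
      congr 3
      field_simp
    rw [h4] at h3
    rw [inner_gradient_left]
    simpa using h3

theorem HolderSemi.continuousOn {A : EucSp n → (EucSp n →L[ℝ] EucSp n)} {γ K : ℝ}
    {D : Set (EucSp n)} (h : HolderSemi A γ K D) (hγ : 0 < γ) : ContinuousOn A D := by
  intro x hx
  refine tendsto_iff_norm_sub_tendsto_zero.2 ?_
  have h1 : Tendsto (fun y => K * ‖y - x‖ ^ γ) (𝓝[D] x) (𝓝 0) := by
    have : ContinuousAt (fun y => K * ‖y - x‖ ^ γ) x :=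
      continuousAt_const.mul (ContinuousAt.rpow_const (by fun_prop) (Or.inr hγ.le))
    have h2 := this.tendsto
    simp only [sub_self, norm_zero, Real.zero_rpow hγ.ne', mul_zero] at h2
    exact h2.mono_left nhdsWithin_le_nhds
  exact squeeze_zero' (Eventually.of_forall fun y => norm_nonneg _)
    (eventually_nhdsWithin_of_forall fun y hy => h y hy x hx) h1

/-- Standing assumptions on the coefficients in a set. -/
structure GoodCoeff (A : EucSp n → (EucSp n →L[ℝ] EucSp n)) (lam Lam γ K : ℝ)
    (D : Set (EucSp n)) : Prop where
  hlam : 0 < lam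
  hLam : lam ≤ Lam
  hγ : γ ∈ Ioo (0 : ℝ) 1
  hK : 0 < K
  ell : IsElliptic A lam Lam D
  symm : IsSymmCoeff A D
  holder : HolderSemi A γ K D

theorem GoodCoeff.isEllMap {A : EucSp n → (EucSp n →L[ℝ] EucSp n)} {lam Lam γ K : ℝ}
    {D : Set (EucSp n)} (h : GoodCoeff A lam Lam γ K D) {x : EucSp n} (hx : x ∈ D) :
    IsEllMap (A x) lam Lam :=
  IsEllMap.of h.hlam h.hLam h.ell h.symm hx

theorem GoodCoeff.rescale {A : EucSp n → (EucSp n →L[ℝ] EucSp n)} {lam Lam γ K : ℝ}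
    {D : Set (EucSp n)} (h : GoodCoeff A lam Lam γ K D) {x : EucSp n} {t R : ℝ} (ht : 0 < t)
    (hD : ball x (t * R) ⊆ D) :
    GoodCoeff (fun z => A (x + t • z)) lam Lam γ (K * t ^ γ) (ball 0 R) := by
  have hmem : ∀ z ∈ ball (0 : EucSp n) R, x + t • z ∈ D := fun z hz => hD (by
    rw [mem_ball_zero_iff] at hz
    rw [mem_ball, dist_self_add_left, norm_smul, Real.norm_of_nonneg ht.le]
    gcongr)
  refine ⟨h.hlam, h.hLam, h.hγ, mul_pos h.hK (Real.rpow_pos_of_pos ht γ),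
    fun z hz => h.ell _ (hmem z hz), fun z hz => h.symm _ (hmem z hz), fun z hz w hw => ?_⟩
  refine (h.holder _ (hmem z hz) _ (hmem w hw)).trans_eq ?_
  rw [add_sub_add_left_eq_sub, ← smul_sub, norm_smul, Real.norm_of_nonneg ht.le,
    Real.mul_rpow ht.le (norm_nonneg _)]
  ring

/-- A function on a ball of radius `2s` is compared with its averages: derivative bound. -/
theorem exists_deriv_average_bound (n : ℕ) {lam Lam γ K : ℝ} (hlam : 0 < lam) (hLam : lam ≤ Lam)
    (hK : 0 < K) :
    ∃ C > (0 : ℝ), ∀ (A : EucSp n → (EucSp n →L[ℝ] EucSp n)) (g v : EucSp n → ℝ) (L : ℝ≥0)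
      (D : Set (EucSp n)) (x : EucSp n) (M ω c t : ℝ), GoodCoeff A lam Lam γ K D →
      WeakBdd A v M D → 0 ≤ M → 0 < ω → 0 < t → t ≤ 1 → ball x (t * 2) ⊆ D →
      LipschitzWith L g → EqOn g v (ball x (t * 2)) → (∀ y ∈ ball x (t * 2), |v y - c| ≤ ω) →
      |∫ z, t⁻¹ * ⟪gradient (fun z => g (x + t • z)) z, z⟫ * ellKer (A x) Lam z|
        ≤ C * (t ^ (γ - 1) * ω + t * M) := by
  obtain ⟨C₀, hC₀, hrad⟩ := exists_radial_bound n hlam hLam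
  have hLam0 : 0 < Lam := hlam.trans_le hLam
  set i₀ : ℝ := 1 / 2 * volume.real (ball (0 : EucSp n) √(lam / (2 * Lam))) with hi₀
  have hi₀pos : 0 < i₀ := by
    refine mul_pos (by norm_num) (ENNReal.toReal_pos (measure_ball_pos volume _ ?_).ne'
      measure_ball_lt_top.ne)
    exact Real.sqrt_pos.2 (div_pos hlam (by positivity))
  refine ⟨i₀⁻¹ * C₀ * (K + 1), by positivity, ?_⟩
  intro A g v L D x M ω c t hA hweak hM hω ht ht1 hD hg hgv hvω
  have hxD : x ∈ D := hD (mem_ball_self (by positivity))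
  have hT := hA.isEllMap hxD
  have hA' := hA.rescale ht hD
  have hmem : ∀ z ∈ ball (0 : EucSp n) 2, x + t • z ∈ ball x (t * 2) := fun z hz => by
    rw [mem_ball_zero_iff] at hz
    rw [mem_ball, dist_self_add_left, norm_smul, Real.norm_of_nonneg ht.le]
    gcongr
  have hgt : LipschitzWith (L * ‖t‖₊) (fun z => g (x + t • z)) := by
    refine LipschitzWith.of_dist_le_mul fun z w => ?_
    refine (hg.dist_le_mul _ _).trans_eq ?_
    rw [dist_add_left, dist_smul₀, NNReal.coe_mul, coe_nnnorm]
    ring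
  have htγ : 0 < t ^ γ := Real.rpow_pos_of_pos ht γ
  have key := hrad (fun z => A (x + t • z)) (fun z => g (x + t • z)) (L * ‖t‖₊) (t ^ 2 * M) ω c
    (K * t ^ γ) hgt (hA'.holder.continuousOn hA.hγ.1) hA'.ell hA'.symm (by positivity) hω
    (by positivity) (fun z hz => by
      simp only [hgv (hmem z hz)]
      exact hvω _ (hmem z hz))
    (fun z hz => by
      have hz2 : z ∈ ball (0 : EucSp n) 2 := ball_subset_ball (by norm_num) hz
      refine (hA'.holder z hz2 0 (mem_ball_self two_pos)).trans ?_
      rw [sub_zero]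
      exact mul_le_of_le_one_right (by positivity)
        (Real.rpow_le_one (norm_nonneg _) (mem_ball_zero_iff.1 hz).le hA.hγ.1.le))
    (hweak.rescale ht hD hgv)
  simp only [smul_zero, add_zero] at key
  set I := ∫ z, ellBump (A x) Lam z with hI
  have hIi : i₀ ≤ I := hT.le_integral_ellBump
  have e : ∫ z, t⁻¹ * ⟪gradient (fun z => g (x + t • z)) z, z⟫ * ellKer (A x) Lam z
      = t⁻¹ * I⁻¹ * ∫ z, ⟪gradient (fun z => g (x + t • z)) z, z⟫ * ellBump (A x) Lam z := by
    rw [← integral_const_mul]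
    refine integral_congr_ae (Eventually.of_forall fun z => ?_)
    simp only [ellKer, ← hI]
    ring
  have hIinv : 0 < I⁻¹ := inv_pos.2 (hi₀pos.trans_le hIi)
  rw [e, abs_mul, abs_of_pos (by positivity)]
  have ht1γ : t ^ γ ≤ 1 := Real.rpow_le_one ht.le ht1 hA.hγ.1.le
  have etγ : t ^ (γ - 1) = t⁻¹ * t ^ γ := by
    rw [Real.rpow_sub_one ht.ne']
    ring
  have h2 : K * t ^ γ * (ω + t ^ 2 * M) + t ^ 2 * M ≤ (K + 1) * (t ^ γ * ω + t ^ 2 * M) := by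
    have h3 : K * (t ^ γ * (t ^ 2 * M)) ≤ K * (1 * (t ^ 2 * M)) := by gcongr
    have h4 : 0 ≤ t ^ γ * ω := by positivity
    nlinarith
  calc t⁻¹ * I⁻¹ * |∫ z, ⟪gradient (fun z => g (x + t • z)) z, z⟫ * ellBump (A x) Lam z|
      ≤ t⁻¹ * i₀⁻¹ * (C₀ * ((K + 1) * (t ^ γ * ω + t ^ 2 * M))) := by
        gcongr
        exact key.trans (by gcongr)
    _ = i₀⁻¹ * C₀ * (K + 1) * (t ^ (γ - 1) * ω + t * M) := by
        rw [etγ]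
        field_simp

/-- Approximate mean value property for solutions. -/
theorem exists_mean_value (n : ℕ) {lam Lam γ K : ℝ} (hlam : 0 < lam) (hLam : lam ≤ Lam)
    (hγ : γ ∈ Ioo (0 : ℝ) 1) (hK : 0 < K) :
    ∃ C > (0 : ℝ), ∀ (A : EucSp n → (EucSp n →L[ℝ] EucSp n)) (v : EucSp n → ℝ)
      (D : Set (EucSp n)) (x : EucSp n) (M ω c s : ℝ), GoodCoeff A lam Lam γ K D →
      WeakBdd A v M D → LocLipOn v D → 0 ≤ M → 0 < ω → 0 < s → s ≤ 1 →
      closedBall x (2 * s) ⊆ D → (∀ y ∈ ball x (2 * s), |v y - c| ≤ ω) →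
      |v x - ∫ z, v (x + s • z) * ellKer (A x) Lam z| ≤ C * (s ^ γ * ω + s ^ 2 * M) := by
  obtain ⟨C₀, hC₀, hder⟩ := exists_deriv_average_bound n (γ := γ) hlam hLam hK
  refine ⟨C₀ / γ, div_pos hC₀ hγ.1, ?_⟩
  intro A v D x M ω c s hA hweak hlip hM hω hs hs1 hD hvω
  have hγ0 := hγ.1
  have hxD : x ∈ D := hD (mem_closedBall_self (by positivity))
  have hT := hA.isEllMap hxD
  have hlip' : LocallyLipschitzOn D v := fun y hy => hlip y hy
  obtain ⟨L, hL⟩ := (hlip'.mono hD).exists_lipschitzOnWith_of_compact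
    (isCompact_closedBall x (2 * s))
  obtain ⟨g, hg, hvg⟩ := hL.extend_real
  set k := ellKer (A x) Lam with hk
  set m : ℝ → ℝ := fun τ => ∫ z, g (x + τ • z) * k z with hm
  have hgc := hg.continuous
  have hkc : Continuous k := continuous_ellKer _ _
  have hm0 : m 0 = v x := by
    simp only [hm, zero_smul, add_zero]
    rw [integral_const_mul, hk, hT.integral_ellKer, mul_one,
      hvg (mem_closedBall_self (by positivity))]
  have hms : m s = ∫ z, v (x + s • z) * k z := by
    refine integral_congr_ae (Eventually.of_forall fun z => ?_)
    rcases le_or_gt 1 ‖z‖ with hz | hz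
    · simp [hk, hT.ellKer_eq_zero hz]
    · have : x + s • z ∈ closedBall x (2 * s) := by
        rw [mem_closedBall, dist_self_add_left, norm_smul, Real.norm_of_nonneg hs.le]
        nlinarith
      simp only [hvg this]
  have hmc : Continuous m := by
    have hint : ∀ τ : ℝ, Integrable fun z => g (x + τ • z) * k z := fun τ =>
      hT.integrable_mul_ellKer (by fun_prop)
    refine LipschitzWith.continuous (K := L) (LipschitzWith.of_dist_le_mul fun τ σ => ?_)
    rw [dist_eq_norm, hm, ← integral_sub (hint τ) (hint σ)]
    refine (norm_integral_le_of_norm_le (hT.integrable_ellKer.const_mul (L * dist τ σ))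
      (Eventually.of_forall fun z => ?_)).trans_eq ?_
    · have hk0 : 0 ≤ k z := ellKer_nonneg _ _ z
      rw [← sub_mul, norm_mul, Real.norm_of_nonneg hk0]
      rcases le_or_gt 1 ‖z‖ with hz | hz
      · simp [hk, hT.ellKer_eq_zero hz]
      · refine mul_le_mul_of_nonneg_right ?_ hk0
        refine (hg.dist_le_mul _ _).trans ?_
        rw [dist_add_left, dist_eq_norm, ← sub_smul, norm_smul, ← dist_eq_norm]
        exact mul_le_mul_of_nonneg_left (mul_le_of_le_one_right dist_nonneg hz.le) L.coe_nonneg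
    · rw [integral_const_mul, hT.integral_ellKer, mul_one]
  have hmd : ∀ τ, 0 < τ → τ ≤ s → ∃ d, HasDerivAt m d τ ∧
      |d| ≤ C₀ * (τ ^ (γ - 1) * ω + τ * M) := by
    intro τ hτ hτs
    have hb : ball x (τ * 2) ⊆ ball x (2 * s) := ball_subset_ball (by linarith)
    refine ⟨_, hasDerivAt_integral_comp_affine hg hkc (ellKer_nonneg _ _)
      (fun z hz => hT.ellKer_eq_zero hz) x hτ, ?_⟩
    exact hder A g v L D x M ω c τ hA hweak hM hω hτ (hτs.trans hs1)
      (hb.trans (ball_subset_closedBall.trans hD)) hg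
      (fun y hy => (hvg (ball_subset_closedBall (hb hy))).symm) fun y hy => hvω y (hb hy)
  set Φ : ℝ → ℝ := fun τ => C₀ * (τ ^ γ / γ * ω + τ ^ 2 / 2 * M) with hΦ
  have hΦc : Continuous Φ := by
    have : Continuous fun τ : ℝ => τ ^ γ := Real.continuous_rpow_const hγ0.le
    fun_prop
  have hΦd : ∀ τ, 0 < τ → HasDerivAt Φ (C₀ * (τ ^ (γ - 1) * ω + τ * M)) τ := by
    intro τ hτ
    have h1 := ((Real.hasDerivAt_rpow_const (p := γ) (Or.inl hτ.ne')).div_const γ).mul_const ω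
    have h2 := (((hasDerivAt_pow 2 τ).div_const 2).mul_const M)
    refine ((h1.add h2).const_mul C₀).congr_deriv ?_
    field_simp
    norm_num
    ring
  have hΦ0 : Φ 0 = 0 := by simp [hΦ, Real.zero_rpow hγ0.ne']
  have hanti : ∀ σ : ℝ, (σ = 1 ∨ σ = -1) → σ * (m s - m 0) ≤ Φ s := by
    intro σ hσ
    have h := antitoneOn_of_deriv_nonpos (convex_Icc (0 : ℝ) s) (f := fun τ => σ * m τ - Φ τ)
      (by fun_prop) (fun τ hτ => ?_) (fun τ hτ => ?_)
    · have := h (left_mem_Icc.2 hs.le) (right_mem_Icc.2 hs.le) hs.le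
      simp only [hΦ0] at this
      linarith
    · rw [interior_Icc] at hτ
      obtain ⟨d, hd, -⟩ := hmd τ hτ.1 hτ.2.le
      exact ((hd.const_mul σ).sub (hΦd τ hτ.1)).differentiableAt.differentiableWithinAt
    · rw [interior_Icc] at hτ
      obtain ⟨d, hd, hdb⟩ := hmd τ hτ.1 hτ.2.le
      have e : HasDerivAt (fun τ => σ * m τ - Φ τ) _ τ := (hd.const_mul σ).sub (hΦd τ hτ.1)
      rw [e.deriv]
      rcases hσ with rfl | rfl <;> linarith [abs_le.1 hdb]
  have h1 := hanti 1 (Or.inl rfl)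
  have h2 := hanti (-1) (Or.inr rfl)
  have h3 : Φ s ≤ C₀ / γ * (s ^ γ * ω + s ^ 2 * M) := by
    have : s ^ 2 / 2 * M ≤ s ^ 2 / γ * M := by
      have := hγ.2
      gcongr
      linarith
    calc Φ s ≤ C₀ * (s ^ γ / γ * ω + s ^ 2 / γ * M) := by
          simp only [hΦ]
          gcongr
      _ = _ := by ring
  rw [← hms, ← hm0]
  exact abs_le.2 ⟨by linarith, by linarith⟩

/-- The radius on which the elliptic kernels are bounded below. -/
def kerRad (lam Lam : ℝ) : ℝ := √(lam / (2 * Lam))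

theorem kerRad_pos {lam Lam : ℝ} (hlam : 0 < lam) (hLam : lam ≤ Lam) : 0 < kerRad lam Lam :=
  Real.sqrt_pos.2 (div_pos hlam (by linarith))

theorem kerRad_sq {lam Lam : ℝ} (hlam : 0 < lam) (hLam : lam ≤ Lam) :
    kerRad lam Lam ^ 2 = lam / (2 * Lam) :=
  Real.sq_sqrt (div_nonneg hlam.le (by linarith))

theorem kerRad_lt_one {lam Lam : ℝ} (hlam : 0 < lam) (hLam : lam ≤ Lam) : kerRad lam Lam < 1 := by
  have h := kerRad_sq hlam hLam
  have h1 : lam / (2 * Lam) < 1 := by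
    rw [div_lt_one (by linarith)]
    linarith
  have := kerRad_pos hlam hLam
  nlinarith

theorem volume_real_ball_pos (n : ℕ) {r : ℝ} (hr : 0 < r) :
    0 < volume.real (ball (0 : EucSp n) r) :=
  ENNReal.toReal_pos (measure_ball_pos volume _ hr).ne' measure_ball_lt_top.ne

theorem IsEllMap.ellKer_le {T : EucSp n →L[ℝ] EucSp n} {lam Lam : ℝ} (hT : IsEllMap T lam Lam)
    (z : EucSp n) :
    ellKer T Lam z ≤ (1 / 2 * volume.real (ball (0 : EucSp n) (kerRad lam Lam)))⁻¹ := by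
  have h1 := volume_real_ball_pos n (kerRad_pos hT.1 hT.2.1)
  have h2 : (∫ z, ellBump T Lam z)⁻¹
      ≤ (1 / 2 * volume.real (ball (0 : EucSp n) (kerRad lam Lam)))⁻¹ :=
    inv_anti₀ (by positivity) hT.le_integral_ellBump
  exact (mul_le_of_le_one_right (inv_nonneg.2 hT.integral_ellBump_pos.le)
    (hT.ellBump_le_one z)).trans h2

theorem IsEllMap.le_ellKer {T : EucSp n →L[ℝ] EucSp n} {lam Lam : ℝ} (hT : IsEllMap T lam Lam)
    {z : EucSp n} (hz : ‖z‖ ≤ kerRad lam Lam) :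
    (volume.real (ball (0 : EucSp n) 1))⁻¹ * (1 / 2) ≤ ellKer T Lam z := by
  have h1 : 1 / 2 ≤ ellBump T Lam z := hT.half_le_ellBump (by
    rw [← kerRad_sq hT.1 hT.2.1]
    gcongr)
  have h2 : (volume.real (ball (0 : EucSp n) 1))⁻¹ ≤ (∫ z, ellBump T Lam z)⁻¹ :=
    inv_anti₀ hT.integral_ellBump_pos hT.integral_ellBump_le
  exact mul_le_mul h2 h1 (by norm_num) (inv_nonneg.2 hT.integral_ellBump_pos.le)

theorem continuousOn_comp_affine {u : EucSp n → ℝ} {x : EucSp n} {s R : ℝ} (hs : 0 ≤ s)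
    (hu : ContinuousOn u (closedBall x R)) (hsR : s ≤ R) :
    ContinuousOn (fun z => u (x + s • z)) (closedBall 0 1) := by
  refine hu.comp (by fun_prop) fun z hz => ?_
  rw [mem_closedBall_zero_iff] at hz
  rw [mem_closedBall, dist_self_add_left, norm_smul, Real.norm_of_nonneg hs]
  nlinarith

/-- Averages with different kernels, centers and scales are comparable. -/
theorem exists_average_compare (n : ℕ) {lam Lam : ℝ} (hlam : 0 < lam) (hLam : lam ≤ Lam) :
    ∃ σ ≥ (2 : ℝ), ∃ C ≥ (1 : ℝ), ∀ (T T' : EucSp n →L[ℝ] EucSp n) (u : EucSp n → ℝ)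
      (x y : EucSp n) (s : ℝ), IsEllMap T lam Lam → IsEllMap T' lam Lam → 0 < s → ‖y - x‖ ≤ s →
      ContinuousOn u (closedBall x (σ * s)) → (∀ w ∈ closedBall x (σ * s), 0 ≤ u w) →
      ∫ z, u (y + s • z) * ellKer T' Lam z
        ≤ C * ∫ z, u (x + (σ * s) • z) * ellKer T Lam z := by
  set ρ := kerRad lam Lam with hρ
  have hρ0 : 0 < ρ := kerRad_pos hlam hLam
  have hρ1 : ρ < 1 := kerRad_lt_one hlam hLam
  set b := (1 / 2 * volume.real (ball (0 : EucSp n) ρ))⁻¹ with hb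
  set a := (volume.real (ball (0 : EucSp n) 1))⁻¹ * (1 / 2) with ha
  have hVρ := volume_real_ball_pos n hρ0
  have hV1 := volume_real_ball_pos n one_pos
  have hapos : 0 < a := by positivity
  have hbpos : 0 < b := by positivity
  have hσ2 : 2 ≤ 2 / ρ := by
    rw [le_div_iff₀ hρ0]
    linarith
  refine ⟨2 / ρ, hσ2, max 1 ((2 / ρ) ^ n * (b / a)), le_max_left _ _, ?_⟩
  intro T T' u x y s hT hT' hs hyx hu hu0
  set σ := 2 / ρ with hσ
  have hσ0 : 0 < σ := by linarith
  have hσρ : σ * ρ = 2 := by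
    rw [hσ]
    field_simp
  have hgi := hT.integrable_mul_ellKer
    (continuousOn_comp_affine (by positivity) hu le_rfl)
  have hmem : ∀ z : EucSp n, ‖z‖ ≤ 1 → x + (σ * s) • z ∈ closedBall x (σ * s) := fun z hz => by
    rw [mem_closedBall, dist_self_add_left, norm_smul, Real.norm_of_nonneg (by positivity)]
    exact mul_le_of_le_one_right (by positivity) hz
  have hg0 : ∀ z, 0 ≤ u (x + (σ * s) • z) * ellKer T Lam z := fun z => by
    rcases le_or_gt 1 ‖z‖ with hz | hz
    · rw [hT.ellKer_eq_zero hz, mul_zero]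
    · exact mul_nonneg (hu0 _ (hmem z hz.le)) (ellKer_nonneg _ _ _)
  have hcv := integral_comp_affine (fun z => u (y + s • z) * ellKer T' Lam z)
    (s⁻¹ • (x - y)) hσ0
  have hpt : ∀ z : EucSp n, y + s • (s⁻¹ • (x - y) + σ • z) = x + (σ * s) • z := fun z => by
    rw [smul_add, smul_smul, smul_smul, mul_inv_cancel₀ hs.ne', one_smul, mul_comm s σ]
    abel
  simp only [hpt] at hcv
  have hle : ∀ z, u (x + (σ * s) • z) * ellKer T' Lam (s⁻¹ • (x - y) + σ • z)
      ≤ b / a * (u (x + (σ * s) • z) * ellKer T Lam z) ∧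
      0 ≤ u (x + (σ * s) • z) * ellKer T' Lam (s⁻¹ • (x - y) + σ • z) := by
    intro z
    set p := s⁻¹ • (x - y) + σ • z with hp
    rcases le_or_gt 1 ‖p‖ with h1 | h1
    · rw [hT'.ellKer_eq_zero h1, mul_zero]
      exact ⟨mul_nonneg (by positivity) (hg0 z), le_rfl⟩
    · have h2 : ‖s⁻¹ • (x - y)‖ ≤ 1 := by
        rw [norm_smul, norm_inv, Real.norm_of_nonneg hs.le, norm_sub_rev,
          inv_mul_le_iff₀ hs, mul_one]
        exact hyx
      have h3 : σ * ‖z‖ ≤ 2 := by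
        have h4 : σ • z = p - s⁻¹ • (x - y) := by
          rw [hp]
          abel
        rw [← Real.norm_of_nonneg hσ0.le, ← norm_smul, h4]
        exact (norm_sub_le _ _).trans (by linarith)
      have h5 : ‖z‖ ≤ ρ := by
        rw [← hσρ] at h3
        exact le_of_mul_le_mul_left h3 hσ0
      have hu' := hu0 _ (hmem z (h5.trans hρ1.le))
      have h6 : ellKer T' Lam p ≤ b := hT'.ellKer_le p
      have h7 : a ≤ ellKer T Lam z := hT.le_ellKer h5
      refine ⟨?_, mul_nonneg hu' (ellKer_nonneg _ _ _)⟩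
      calc u (x + (σ * s) • z) * ellKer T' Lam p ≤ u (x + (σ * s) • z) * b := by gcongr
        _ = b / a * (u (x + (σ * s) • z) * a) := by field_simp
        _ ≤ _ := by gcongr
  have hmono := integral_mono_of_nonneg (Eventually.of_forall fun z => (hle z).2)
    (hgi.const_mul (b / a)) (Eventually.of_forall fun z => (hle z).1)
  rw [integral_const_mul] at hmono
  have e : ∫ z, u (y + s • z) * ellKer T' Lam z
      = σ ^ n * ∫ z, u (x + (σ * s) • z) * ellKer T' Lam (s⁻¹ • (x - y) + σ • z) := by
    rw [hcv, ← mul_assoc, mul_inv_cancel₀ (by positivity), one_mul]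
  rw [e]
  calc σ ^ n * ∫ z, u (x + (σ * s) • z) * ellKer T' Lam (s⁻¹ • (x - y) + σ • z)
      ≤ σ ^ n * (b / a * ∫ z, u (x + (σ * s) • z) * ellKer T Lam z) := by gcongr
    _ = σ ^ n * (b / a) * ∫ z, u (x + (σ * s) • z) * ellKer T Lam z := by ring
    _ ≤ _ := mul_le_mul_of_nonneg_right (le_max_right _ _) (integral_nonneg hg0)

/-- Chaining one-sided local comparisons along a segment. -/
theorem le_pow_mul_of_chain {u : EucSp n → ℝ} {S : Set (EucSp n)} (hS : Convex ℝ S) {H δ : ℝ}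
    (hH : 0 ≤ H) (h : ∀ p ∈ S, ∀ q ∈ S, ‖q - p‖ ≤ δ → u q ≤ H * u p) (k : ℕ) {x y : EucSp n}
    (hx : x ∈ S) (hy : y ∈ S) (hxy : ‖y - x‖ ≤ k * δ) : u y ≤ H ^ k * u x := by
  induction k generalizing y with
  | zero =>
    have : y = x := by simpa [sub_eq_zero] using hxy
    simp [this]
  | succ k ih =>
    set t : ℝ := k / (k + 1) with ht
    have hk : (0 : ℝ) < k + 1 := by positivity
    have ht0 : 0 ≤ t := by positivity
    have ht1 : 1 - t = 1 / (k + 1) := by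
      rw [ht]
      field_simp
      ring
    have hp : x + t • (y - x) ∈ S :=
      hS.add_smul_sub_mem hx hy ⟨ht0, by
        have : 0 ≤ 1 - t := by rw [ht1]; positivity
        linarith⟩
    push_cast at hxy
    have h1 := ih hp (by
      rw [add_sub_cancel_left, norm_smul, Real.norm_of_nonneg ht0]
      calc t * ‖y - x‖ ≤ t * ((k + 1) * δ) := by gcongr
        _ = k * δ := by
          rw [ht]
          field_simp)
    have h2 := h _ hp y hy (by
      have e : y - (x + t • (y - x)) = (1 - t) • (y - x) := by
        rw [sub_smul, one_smul]
        abel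
      rw [e, ht1, norm_smul, Real.norm_of_nonneg (by positivity)]
      calc 1 / (k + 1) * ‖y - x‖ ≤ 1 / (k + 1) * ((k + 1) * δ) := by gcongr
        _ = δ := by field_simp)
    calc u y ≤ H * u (x + t • (y - x)) := h2
      _ ≤ H * (H ^ k * u x) := by gcongr
      _ = _ := by ring

set_option maxHeartbeats 1000000 in
/-- Doubling the range of a Harnack inequality. -/
theorem exists_harnack_step (n : ℕ) {lam Lam γ K : ℝ} (hlam : 0 < lam) (hLam : lam ≤ Lam)
    (hγ : γ ∈ Ioo (0 : ℝ) 1) (hK : 0 < K) :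
    ∃ θ₀ > (0 : ℝ), θ₀ ≤ 1 / 8 ∧ ∃ H ≥ (2 : ℝ), ∀ (A : EucSp n → (EucSp n →L[ℝ] EucSp n))
      (v : EucSp n → ℝ) (x₀ : EucSp n) (R M P θ : ℝ), R ≤ 1 →
      GoodCoeff A lam Lam γ K (ball x₀ R) → WeakBdd A v M (ball x₀ R) → LocLipOn v (ball x₀ R) →
      ContinuousOn v (closedBall x₀ R) → (∀ x ∈ closedBall x₀ R, 0 ≤ v x) → 0 ≤ M →
      M * R ^ 2 ≤ P → 0 < P → 0 < θ → θ ≤ θ₀ →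
      (∀ x ∈ ball x₀ R, ∀ y, ‖y - x‖ ≤ θ * (R - ‖x - x₀‖) → v y + P ≤ H * (v x + P)) →
      ∀ x ∈ ball x₀ R, ∀ y, ‖y - x‖ ≤ 2 * θ * (R - ‖x - x₀‖) → v y + P ≤ H * (v x + P) := by
  obtain ⟨C₁, hC₁, hmv⟩ := exists_mean_value n hlam hLam hγ hK
  obtain ⟨σ, hσ, C₂, hC₂, hcmp⟩ := exists_average_compare n hlam hLam
  have hγ0 := hγ.1
  set H := 2 * C₂ with hH
  have hH2 : 2 ≤ H := by linarith
  set k := ⌈8 * σ⌉₊ with hk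
  set e := 1 / (2 * (C₁ * (H ^ k + 1))) with he
  have he0 : 0 < e := by positivity
  refine ⟨min (e ^ γ⁻¹) (1 / 4) / (2 * σ), by positivity, ?_, H, hH2, ?_⟩
  · rw [div_le_iff₀ (by positivity)]
    linarith [min_le_right (e ^ γ⁻¹) (1 / 4)]
  intro A v x₀ R M P θ hR1 hA hw hl hc hv0 hM hMP hP hθ hθ0 h x hx y hy
  set d := R - ‖x - x₀‖ with hd
  have hd0 : 0 < d := by
    rw [mem_ball, dist_eq_norm] at hx
    linarith
  have hdR : d ≤ R := by linarith [norm_nonneg (x - x₀)]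
  set q := 2 * σ * θ with hq
  have hq0 : 0 < q := by positivity
  have hqm : q ≤ min (e ^ γ⁻¹) (1 / 4) := by
    rw [le_div_iff₀ (by positivity)] at hθ0
    linarith
  have hq4 : q ≤ 1 / 4 := hqm.trans (min_le_right _ _)
  have hqe : q ^ γ ≤ e := by
    have := Real.rpow_le_rpow hq0.le (hqm.trans (min_le_left _ _)) hγ0.le
    rwa [← Real.rpow_mul he0.le, inv_mul_cancel₀ hγ0.ne', Real.rpow_one] at this
  set s := 2 * θ * d with hs
  have hs0 : 0 < s := by positivity
  have hσs : σ * s = q * d := by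
    rw [hs, hq]
    ring
  have hsub : closedBall x (2 * (σ * s)) ⊆ ball x₀ R := by
    refine (closedBall_subset_ball (ε₂ := d) ?_).trans (ball_subset_ball' ?_)
    · rw [hσs]
      nlinarith
    · rw [dist_eq_norm, hd, sub_add_cancel]
  set S := closedBall x (2 * (σ * s)) with hS
  have hu0 : ∀ p ∈ S, 0 < v p + P := fun p hp => by
    linarith [hv0 p (ball_subset_closedBall (hsub hp))]
  have hxS : x ∈ S := mem_closedBall_self (by positivity)
  have hux := hu0 x hxS
  set ω := H ^ k * (v x + P) with hω
  have hω0 : 0 < ω := by positivity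
  have hsup : ∀ p ∈ S, v p + P ≤ ω := by
    intro p hp
    refine le_pow_mul_of_chain (u := fun p => v p + P) (convex_closedBall x _) (δ := θ * d / 2)
      (by linarith) (fun p hp q' hq' hpq => h p (hsub hp) q' (hpq.trans ?_)) k hxS hp ?_
    · have h1 : ‖p - x₀‖ ≤ ‖p - x‖ + ‖x - x₀‖ := norm_sub_le_norm_sub_add_norm_sub _ _ _
      rw [mem_closedBall, dist_eq_norm, hσs] at hp
      have : d / 2 ≤ R - ‖p - x₀‖ := by nlinarith
      nlinarith
    · rw [hS, mem_closedBall, dist_eq_norm] at hp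
      refine hp.trans ?_
      have h1 : 8 * σ ≤ k := Nat.le_ceil _
      calc 2 * (σ * s) = 8 * σ * (θ * d / 2) := by
            rw [hs]
            ring
        _ ≤ _ := by gcongr
  have habs : ∀ p ∈ S, |v p - -P| ≤ ω := fun p hp => by
    rw [sub_neg_eq_add, abs_of_pos (hu0 p hp)]
    exact hsup p hp
  have hint : ∀ T : EucSp n →L[ℝ] EucSp n, IsEllMap T lam Lam → ∀ (p : EucSp n) (t : ℝ), 0 ≤ t →
      closedBall p t ⊆ S → ∫ z, (v (p + t • z) + P) * ellKer T Lam z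
        = (∫ z, v (p + t • z) * ellKer T Lam z) + P := by
    intro T hT p t ht hp
    have h1 := hT.integrable_mul_ellKer (continuousOn_comp_affine ht
      (hc.mono ((hp.trans hsub).trans ball_subset_closedBall)) le_rfl)
    simp only [add_mul]
    rw [integral_add h1 (hT.integrable_ellKer.const_mul P), integral_const_mul,
      hT.integral_ellKer, mul_one]
  have herr : ∀ t, 0 < t → t ≤ σ * s → C₁ * (t ^ γ * ω + t ^ 2 * M) ≤ (v x + P) / 2 := by
    intro t ht0 ht
    have htq : t ≤ q * R := ht.trans (hσs.trans_le (by gcongr))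
    have htq1 : t ≤ q := htq.trans (mul_le_of_le_one_right hq0.le hR1)
    have h1 : t ^ γ ≤ q ^ γ := Real.rpow_le_rpow ht0.le htq1 hγ0.le
    have h2 : t ^ 2 * M ≤ q ^ γ * (v x + P) := by
      have h3 : q ^ 2 ≤ q ^ γ := by
        rw [← Real.rpow_natCast]
        exact Real.rpow_le_rpow_of_exponent_ge hq0 (by linarith)
          (by push_cast; linarith [hγ.2])
      calc t ^ 2 * M ≤ (q * R) ^ 2 * M := by gcongr
        _ = q ^ 2 * (M * R ^ 2) := by ring
        _ ≤ q ^ γ * (v x + P) := by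
            have := hv0 x (ball_subset_closedBall hx)
            gcongr
            linarith
    calc C₁ * (t ^ γ * ω + t ^ 2 * M) ≤ C₁ * (q ^ γ * ω + q ^ γ * (v x + P)) := by gcongr
      _ = q ^ γ * (C₁ * (H ^ k + 1)) * (v x + P) := by
          rw [hω]
          ring
      _ ≤ e * (C₁ * (H ^ k + 1)) * (v x + P) := by gcongr
      _ = (v x + P) / 2 := by
          rw [he]
          field_simp
  have hle1 : σ * s ≤ 1 := by
    rw [hσs]
    nlinarith
  have hss : s ≤ σ * s := by nlinarith
  have hyS : closedBall y (2 * s) ⊆ S := closedBall_subset_closedBall' (by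
    rw [dist_eq_norm]
    nlinarith)
  have hyb : y ∈ ball x₀ R := hsub (hyS (mem_closedBall_self (by positivity)))
  have hx1 := hmv A v (ball x₀ R) x M ω (-P) (σ * s) hA hw hl hM hω0 (by positivity) hle1 hsub
    fun p hp => habs p (ball_subset_closedBall hp)
  have hy1 := hmv A v (ball x₀ R) y M ω (-P) s hA hw hl hM hω0 hs0 (hss.trans hle1)
    (hyS.trans hsub) fun p hp => habs p (hyS (ball_subset_closedBall hp))
  have hTx := hA.isEllMap hx
  have hTy := hA.isEllMap hyb
  have hxs : closedBall x (σ * s) ⊆ S := closedBall_subset_closedBall (by nlinarith)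
  have h1 := hcmp (A x) (A y) (fun p => v p + P) x y s hTx hTy hs0 hy
    ((hc.mono ((hxs.trans hsub).trans ball_subset_closedBall)).add continuousOn_const)
    fun w hw => (hu0 w (hxs hw)).le
  rw [hint _ hTx x _ (by positivity) hxs, hint _ hTy y _ hs0.le
    ((closedBall_subset_closedBall (by linarith)).trans hyS)] at h1
  have h2 := (abs_le.1 (hx1.trans (herr _ (by positivity) le_rfl))).1
  have h3 := (abs_le.1 (hy1.trans (herr _ hs0 hss))).2
  nlinarith

/-- Harnack's inequality on small balls. -/
theorem exists_harnack (n : ℕ) {lam Lam γ K : ℝ} (hlam : 0 < lam) (hLam : lam ≤ Lam)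
    (hγ : γ ∈ Ioo (0 : ℝ) 1) (hK : 0 < K) :
    ∃ θ > (0 : ℝ), θ ≤ 1 / 8 ∧ ∃ H ≥ (1 : ℝ), ∀ (A : EucSp n → (EucSp n →L[ℝ] EucSp n))
      (v : EucSp n → ℝ) (x₀ : EucSp n) (R M : ℝ), R ≤ 1 →
      GoodCoeff A lam Lam γ K (ball x₀ R) → WeakBdd A v M (ball x₀ R) → LocLipOn v (ball x₀ R) →
      ContinuousOn v (closedBall x₀ R) → (∀ x ∈ closedBall x₀ R, 0 ≤ v x) → 0 ≤ M →
      ∀ x ∈ ball x₀ R, ∀ y, ‖y - x‖ ≤ θ * (R - ‖x - x₀‖) →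
        v y + M * R ^ 2 ≤ H * (v x + M * R ^ 2) := by
  obtain ⟨θ₀, hθ₀, hθ₀8, H, hH, hstep⟩ := exists_harnack_step n hlam hLam hγ hK
  refine ⟨θ₀, hθ₀, hθ₀8, H, by linarith, ?_⟩
  intro A v x₀ R M hR hA hw hl hc hv0 hM x hx y hy
  have main : ∀ η > (0 : ℝ), v y + (M * R ^ 2 + η) ≤ H * (v x + (M * R ^ 2 + η)) := by
    intro η hη
    set P := M * R ^ 2 + η with hP
    have hP0 : 0 < P := by positivity
    obtain ⟨δ, hδ, hδv⟩ := Metric.uniformContinuousOn_iff.1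
      ((isCompact_closedBall x₀ R).uniformContinuousOn_of_continuous hc) P hP0
    have hmem : ∀ p ∈ ball x₀ R, ∀ q, ‖q - p‖ ≤ R - ‖p - x₀‖ → q ∈ closedBall x₀ R := by
      intro p _ q hpq
      rw [mem_closedBall, dist_eq_norm]
      linarith [norm_sub_le_norm_sub_add_norm_sub q p x₀]
    obtain ⟨N, hN⟩ := exists_nat_gt (θ₀ * 1 / δ)
    have key : ∀ j : ℕ, ∀ p ∈ ball x₀ R, ∀ q,
        ‖q - p‖ ≤ θ₀ / 2 ^ N * 2 ^ min j N * (R - ‖p - x₀‖) → v q + P ≤ H * (v p + P) := by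
      intro j
      induction j with
      | zero =>
        intro p hp q hpq
        have hp' := hp
        rw [mem_ball, dist_eq_norm] at hp'
        have hNN : (N : ℝ) < 2 ^ N := by exact_mod_cast Nat.lt_two_pow_self
        have h2N : (1 : ℝ) ≤ 2 ^ N := one_le_pow₀ (by norm_num)
        simp only [Nat.zero_min, pow_zero, mul_one] at hpq
        have h1 : θ₀ / 2 ^ N ≤ 1 := by
          rw [div_le_one (by positivity)]
          linarith
        have h2 : θ₀ / 2 ^ N < δ := by
          rw [mul_one, div_lt_iff₀ hδ] at hN
          rw [div_lt_iff₀ (by positivity)]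
          nlinarith
        have h3 : R - ‖p - x₀‖ ≤ 1 := by linarith [norm_nonneg (p - x₀)]
        have h4 : ‖q - p‖ ≤ R - ‖p - x₀‖ := hpq.trans (by nlinarith)
        have h5 : ‖q - p‖ < δ := by
          have : 0 < θ₀ / 2 ^ N := by positivity
          nlinarith
        have h6 := hδv q (hmem p hp q h4) p (ball_subset_closedBall hp) (by
          rwa [dist_eq_norm])
        rw [Real.dist_eq] at h6
        have h7 := hv0 p (ball_subset_closedBall hp)
        nlinarith [(abs_lt.1 h6).2]
      | succ j ih =>
        rcases le_or_gt N j with hj | hj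
        · rw [min_eq_right hj] at ih
          rwa [min_eq_right (hj.trans (Nat.le_succ j))]
        · rw [min_eq_left hj.le] at ih
          rw [min_eq_left (Nat.succ_le_of_lt hj)]
          have e : θ₀ / 2 ^ N * 2 ^ (j + 1) = 2 * (θ₀ / 2 ^ N * 2 ^ j) := by ring
          rw [e]
          refine hstep A v x₀ R M P _ hR hA hw hl hc hv0 hM (by linarith) hP0 (by positivity) ?_ ih
          rw [div_mul_eq_mul_div, div_le_iff₀ (by positivity)]
          gcongr
          norm_num
    refine key N x hx y ?_
    rwa [min_self, div_mul_cancel₀ _ (by positivity)]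
  refine le_of_forall_pos_le_add fun ε hε => ?_
  have h := main (ε / H) (by positivity)
  have : H * (ε / H) = ε := by field_simp
  have : 0 < ε / H := by positivity
  nlinarith

/-- Odd functions have vanishing averages. -/
theorem integral_odd_mul_ellKer (T : EucSp n →L[ℝ] EucSp n) (Lam : ℝ) {g : EucSp n → ℝ}
    (hg : ∀ z, g (-z) = -g z) : ∫ z, g z * ellKer T Lam z = 0 := by
  have h := integral_neg_eq_self (fun z => g z * ellKer T Lam z) volume
  simp only [hg, ellKer_neg, neg_mul, integral_neg] at h
  linarith

/-- Nondegeneracy of the second moments of the elliptic kernels. -/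
theorem exists_le_second_moment (n : ℕ) {lam Lam : ℝ} (hlam : 0 < lam) (hLam : lam ≤ Lam) :
    ∃ c₀ > (0 : ℝ), ∀ (T : EucSp n →L[ℝ] EucSp n) (x : EucSp n), IsEllMap T lam Lam →
      c₀ * ‖x‖ ^ 2 ≤ ∫ z, ⟪x, z⟫ ^ 2 * ellKer T Lam z := by
  have hρ := kerRad_pos hlam hLam
  have hρ1 := kerRad_lt_one hlam hLam
  set ρ := kerRad lam Lam
  set a := (volume.real (ball (0 : EucSp n) 1))⁻¹ * (1 / 2)
  have ha : 0 < a := by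
    have := volume_real_ball_pos n one_pos
    positivity
  have hV := volume_real_ball_pos n (show 0 < ρ / 4 by positivity)
  refine ⟨ρ ^ 2 / 16 * a * volume.real (ball (0 : EucSp n) (ρ / 4)), by positivity, ?_⟩
  intro T x hT
  have hnn : ∀ z, 0 ≤ ⟪x, z⟫ ^ 2 * ellKer T Lam z := fun z =>
    mul_nonneg (sq_nonneg _) (ellKer_nonneg _ _ _)
  have hi : Integrable fun z => ⟪x, z⟫ ^ 2 * ellKer T Lam z :=
    hT.integrable_mul_ellKer (by fun_prop)
  rcases eq_or_ne x 0 with rfl | hx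
  · simp
  have hx0 : 0 < ‖x‖ := norm_pos_iff.2 hx
  set e := (ρ / (2 * ‖x‖)) • x with he
  have hen : ‖e‖ = ρ / 2 := by
    rw [he, norm_smul, Real.norm_of_nonneg (by positivity)]
    field_simp
  have hex : ⟪x, e⟫ = ρ / 2 * ‖x‖ := by
    rw [he, inner_smul_right, real_inner_self_eq_norm_sq]
    field_simp
  have hvol : volume.real (ball e (ρ / 4)) = volume.real (ball (0 : EucSp n) (ρ / 4)) :=
    congrArg ENNReal.toReal (Measure.addHaar_ball_center _ _ _)
  refine le_trans ?_ (setIntegral_le_integral (s := ball e (ρ / 4)) hi (Eventually.of_forall hnn))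
  have h1 : ∀ z ∈ ball e (ρ / 4), ρ ^ 2 / 16 * a * ‖x‖ ^ 2 ≤ ⟪x, z⟫ ^ 2 * ellKer T Lam z := by
    intro z hz
    rw [mem_ball, dist_eq_norm] at hz
    have h2 : ‖z‖ ≤ ρ := by
      have := norm_le_norm_add_norm_sub e z
      rw [norm_sub_rev] at this
      linarith
    have h3 : ρ / 4 * ‖x‖ ≤ ⟪x, z⟫ := by
      have h4 : ⟪x, z⟫ = ⟪x, e⟫ + ⟪x, z - e⟫ := by
        rw [← inner_add_right, add_sub_cancel]
      have h5 := (abs_le.1 (abs_real_inner_le_norm x (z - e))).1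
      nlinarith
    calc ρ ^ 2 / 16 * a * ‖x‖ ^ 2 = (ρ / 4 * ‖x‖) ^ 2 * a := by ring
      _ ≤ _ := mul_le_mul (by gcongr) (hT.le_ellKer h2) ha.le (sq_nonneg _)
  have h6 := setIntegral_mono_on (μ := volume) (integrableOn_const measure_ball_lt_top.ne)
    hi.integrableOn measurableSet_ball h1
  rw [setIntegral_const, smul_eq_mul, hvol] at h6
  linarith

theorem le_integral_mul_ellKer {T : EucSp n →L[ℝ] EucSp n} {lam Lam : ℝ} (hT : IsEllMap T lam Lam)
    {u : EucSp n → ℝ} (hu : ContinuousOn u (closedBall 0 1)) {x : EucSp n} {a b c m : ℝ}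
    (h : ∀ z, ‖z‖ ≤ 1 → c + ⟪x, z⟫ * (a + b * ‖z‖ ^ 2) + m * ⟪x, z⟫ ^ 2 ≤ u z) :
    c + m * ∫ z, ⟪x, z⟫ ^ 2 * ellKer T Lam z ≤ ∫ z, u z * ellKer T Lam z := by
  have h1 : Integrable fun z => ⟪x, z⟫ * (a + b * ‖z‖ ^ 2) * ellKer T Lam z :=
    hT.integrable_mul_ellKer (by fun_prop)
  have h2 : Integrable fun z => ⟪x, z⟫ ^ 2 * ellKer T Lam z :=
    hT.integrable_mul_ellKer (by fun_prop)
  have h3 := hT.integrable_ellKer.const_mul c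
  have h4 : ∫ z, ⟪x, z⟫ * (a + b * ‖z‖ ^ 2) * ellKer T Lam z = 0 :=
    integral_odd_mul_ellKer T Lam fun z => by
      rw [inner_neg_right, norm_neg]
      ring
  have h31 : Integrable fun z => c * ellKer T Lam z + ⟪x, z⟫ * (a + b * ‖z‖ ^ 2) * ellKer T Lam z :=
    h3.add h1
  have h5 : ∫ z, ((c * ellKer T Lam z + ⟪x, z⟫ * (a + b * ‖z‖ ^ 2) * ellKer T Lam z)
      + m * (⟪x, z⟫ ^ 2 * ellKer T Lam z)) = c + m * ∫ z, ⟪x, z⟫ ^ 2 * ellKer T Lam z := by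
    rw [integral_add h31 (h2.const_mul m), integral_add h3 h1, integral_const_mul,
      integral_const_mul, hT.integral_ellKer, h4, mul_one, add_zero]
  rw [← h5]
  refine integral_mono (h31.add (h2.const_mul m)) (hT.integrable_mul_ellKer hu) fun z => ?_
  rcases le_or_gt 1 ‖z‖ with hz | hz
  · simp [hT.ellKer_eq_zero hz]
  · have := mul_le_mul_of_nonneg_right (h z hz.le) (ellKer_nonneg T Lam z)
    simp only
    linarith

/-- A second order lower bound for powers. -/
theorem le_one_add_rpow {β τ : ℝ} (hβ : β ∈ Ioo (0 : ℝ) 1) (hτ : |τ| ≤ 1 / 2) :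
    1 + (1 + β) * τ + β ^ 2 / 2 * τ ^ 2 ≤ (1 + τ) ^ (1 + β) := by
  obtain ⟨h0, h1⟩ := hβ
  obtain ⟨h2, h3⟩ := abs_le.1 hτ
  have hp : 0 < 1 + τ := by linarith
  have h4 : (1 + τ) ^ (1 - β) ≤ 1 + (1 - β) * τ :=
    rpow_one_add_le_one_add_mul_self (by linarith) (by linarith) (by linarith)
  have h5 : (1 + τ) ^ (1 + β) * (1 + τ) ^ (1 - β) = (1 + τ) ^ 2 := by
    rw [← Real.rpow_add hp, ← Real.rpow_natCast]
    congr 1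
    push_cast
    ring
  have h6 : 0 < (1 + τ) ^ (1 + β) := Real.rpow_pos_of_pos hp _
  have h7 : (1 + τ) ^ 2 ≤ (1 + τ) ^ (1 + β) * (1 + (1 - β) * τ) := by
    rw [← h5]
    gcongr
  have h8 : 0 < 1 + (1 - β) * τ := by nlinarith
  have h9 : 1 + (1 - β) * τ ≤ 2 := by nlinarith
  refine le_of_mul_le_mul_right (le_trans ?_ h7) h8
  nlinarith [sq_nonneg (β * τ)]

/-- The barrier `D + D^(1+β)` with `D = 1 - |x|²`. -/
def barrier (β : ℝ) (x : EucSp n) : ℝ := (1 - ‖x‖ ^ 2) + (1 - ‖x‖ ^ 2) ^ (1 + β)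

theorem continuous_barrier {β : ℝ} (hβ : 0 < β) : Continuous (barrier (n := n) β) := by
  have := Real.continuous_rpow_const (show 0 ≤ 1 + β by linarith)
  unfold barrier
  fun_prop

/-- The barrier is a strict discrete subsolution near the unit sphere. -/
theorem exists_average_barrier (n : ℕ) {lam Lam β : ℝ} (hlam : 0 < lam) (hLam : lam ≤ Lam)
    (hβ : β ∈ Ioo (0 : ℝ) 1) :
    ∃ c > (0 : ℝ), ∀ (T : EucSp n →L[ℝ] EucSp n) (x : EucSp n) (κ D : ℝ), IsEllMap T lam Lam →
      D = 1 - ‖x‖ ^ 2 → 0 < D → D ≤ 3 / 4 → 0 < κ → κ ≤ 1 / 6 →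
      barrier β x + κ ^ 2 * (c * D ^ (1 + β) - 3 * D ^ 2)
        ≤ ∫ z, barrier β (x + (κ * D) • z) * ellKer T Lam z := by
  obtain ⟨c₀, hc₀, hmom⟩ := exists_le_second_moment n hlam hLam
  have hβ0 := hβ.1
  have hβ1 := hβ.2
  refine ⟨β ^ 2 * c₀ / 2, by positivity, ?_⟩
  intro T x κ D hT hD hD0 hD1 hκ hκ1
  set E := D ^ (1 + β) with hE
  have hE0 : 0 < E := Real.rpow_pos_of_pos hD0 _
  have hED : E ≤ D := by
    simpa using Real.rpow_le_rpow_of_exponent_ge hD0 (by linarith) (show 1 ≤ 1 + β by linarith)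
  have hWx : barrier β x = D + E := by rw [barrier, ← hD]
  set B := D + (1 + β) * E with hB
  have hB3 : B ≤ 3 * D := by nlinarith
  have hB0 : 0 < B := by positivity
  have hx1 : ‖x‖ ≤ 1 := by nlinarith [norm_nonneg x]
  have h := le_integral_mul_ellKer hT (u := fun z => barrier β (x + (κ * D) • z)) (x := x)
    (a := -(2 * κ * B)) (b := 2 * κ ^ 3 * β ^ 2 * E * D) (c := D + E - 3 * κ ^ 2 * D ^ 2)
    (m := 2 * κ ^ 2 * β ^ 2 * E)
    (((continuous_barrier hβ0).comp (by fun_prop)).continuousOn) ?_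
  · rw [hWx]
    refine le_trans ?_ h
    have h1 : c₀ / 4 ≤ ∫ z, ⟪x, z⟫ ^ 2 * ellKer T Lam z := by
      refine le_trans ?_ (hmom T x hT)
      nlinarith
    have h2 : 2 * κ ^ 2 * β ^ 2 * E * (c₀ / 4)
        ≤ 2 * κ ^ 2 * β ^ 2 * E * ∫ z, ⟪x, z⟫ ^ 2 * ellKer T Lam z := by gcongr
    linarith
  · intro z hz
    set p := ⟪x, z⟫ with hp
    set τ := -(2 * κ * p + κ ^ 2 * D * ‖z‖ ^ 2) with hτ
    have hz2 : ‖z‖ ^ 2 ≤ 1 := by nlinarith [norm_nonneg z]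
    have hz0 : 0 ≤ ‖z‖ ^ 2 := sq_nonneg _
    have hp1 : |p| ≤ 1 := (abs_real_inner_le_norm x z).trans
      (mul_le_one₀ hx1 (norm_nonneg _) hz)
    have hτ2 : |τ| ≤ 1 / 2 := by
      rw [hτ, abs_neg]
      refine (abs_add_le _ _).trans ?_
      rw [abs_mul, abs_of_pos (show 0 < 2 * κ by positivity),
        abs_of_nonneg (show 0 ≤ κ ^ 2 * D * ‖z‖ ^ 2 by positivity)]
      have h3 : κ ^ 2 * D * ‖z‖ ^ 2 ≤ κ ^ 2 * 1 * 1 := by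
        gcongr
        linarith
      nlinarith
    have hDz : 1 - ‖x + (κ * D) • z‖ ^ 2 = D * (1 + τ) := by
      rw [norm_add_sq_real, inner_smul_right, norm_smul, Real.norm_of_nonneg (by positivity),
        hτ, ← hp]
      linear_combination (-1 : ℝ) * hD
    have hτ' := abs_le.1 hτ2
    have h4 : E * (1 + (1 + β) * τ + β ^ 2 / 2 * τ ^ 2) ≤ (D * (1 + τ)) ^ (1 + β) := by
      rw [Real.mul_rpow hD0.le (by linarith)]
      exact mul_le_mul_of_nonneg_left (le_one_add_rpow hβ hτ2) hE0.le
    have h5 : 4 * κ ^ 2 * p ^ 2 + 4 * κ ^ 3 * D * p * ‖z‖ ^ 2 ≤ τ ^ 2 := by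
      rw [hτ]
      nlinarith [sq_nonneg (κ ^ 2 * D * ‖z‖ ^ 2)]
    have h6 : β ^ 2 / 2 * E * (4 * κ ^ 2 * p ^ 2 + 4 * κ ^ 3 * D * p * ‖z‖ ^ 2)
        ≤ β ^ 2 / 2 * E * τ ^ 2 := by gcongr
    have h7 : B * (κ ^ 2 * D * ‖z‖ ^ 2) ≤ 3 * D * (κ ^ 2 * D * 1) := by gcongr
    have h8 : B * τ = -(2 * κ * B) * p - B * (κ ^ 2 * D * ‖z‖ ^ 2) := by
      rw [hτ]
      ring
    rw [barrier, hDz]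
    have h9 : B * τ = D * τ + E * ((1 + β) * τ) := by
      rw [hB]
      ring
    linarith

/-- Nonnegative solutions in the ball `ball x₀ R`, continuous up to the boundary. -/
structure NonnegSol (A : EucSp n → (EucSp n →L[ℝ] EucSp n)) (v : EucSp n → ℝ)
    (lam Lam γ K M : ℝ) (x₀ : EucSp n) (R : ℝ) : Prop where
  coeff : GoodCoeff A lam Lam γ K (ball x₀ R)
  weak : WeakBdd A v M (ball x₀ R)
  lip : LocLipOn v (ball x₀ R)
  cont : ContinuousOn v (closedBall x₀ R)
  nonneg : ∀ x ∈ closedBall x₀ R, 0 ≤ v x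
  hM : 0 ≤ M

theorem GoodCoeff.mono_const {A : EucSp n → (EucSp n →L[ℝ] EucSp n)} {lam Lam γ K K' : ℝ}
    {D : Set (EucSp n)} (h : GoodCoeff A lam Lam γ K D) (hK : K ≤ K') :
    GoodCoeff A lam Lam γ K' D where
  hlam := h.hlam
  hLam := h.hLam
  hγ := h.hγ
  hK := h.hK.trans_le hK
  ell := h.ell
  symm := h.symm
  holder := fun x hx y hy => (h.holder x hx y hy).trans (by gcongr)

theorem LocLipOn.comp_affine {v : EucSp n → ℝ} {D D' : Set (EucSp n)} (h : LocLipOn v D)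
    (x : EucSp n) (s : ℝ) (hD : MapsTo (fun z => x + s • z) D' D) :
    LocLipOn (fun z => v (x + s • z)) D' := by
  have hlip : LipschitzWith ‖s‖₊ fun z : EucSp n => x + s • z :=
    LipschitzWith.of_dist_le_mul fun p q => by
      rw [dist_add_left, dist_smul₀]
      rfl
  intro z hz
  obtain ⟨L, t, ht, hL⟩ := h _ (hD hz)
  refine ⟨L * ‖s‖₊, (fun z => x + s • z) ⁻¹' t, ?_, hL.comp hlip.lipschitzOnWith
    (mapsTo_preimage _ _)⟩
  exact (hlip.continuous.continuousWithinAt.tendsto_nhdsWithin hD) ht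

theorem NonnegSol.rescale {A : EucSp n → (EucSp n →L[ℝ] EucSp n)} {v : EucSp n → ℝ}
    {lam Lam γ K M R R' s : ℝ} {x₀ x : EucSp n} (h : NonnegSol A v lam Lam γ K M x₀ R)
    (hs : 0 < s) (hs1 : s ≤ 1) (hx : s * R' + ‖x - x₀‖ ≤ R) :
    NonnegSol (fun z => A (x + s • z)) (fun z => v (x + s • z)) lam Lam γ K (s ^ 2 * M) 0 R' := by
  have hball : ball x (s * R') ⊆ ball x₀ R := ball_subset_ball' (by rwa [dist_eq_norm])
  have hcl : MapsTo (fun z : EucSp n => x + s • z) (closedBall 0 R') (closedBall x₀ R) := by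
    intro z hz
    rw [mem_closedBall_zero_iff] at hz
    refine closedBall_subset_closedBall' (by rwa [dist_eq_norm]) (?_ : _ ∈ closedBall x (s * R'))
    rw [mem_closedBall, dist_self_add_left, norm_smul, Real.norm_of_nonneg hs.le]
    gcongr
  have hop : MapsTo (fun z : EucSp n => x + s • z) (ball 0 R') (ball x₀ R) := by
    intro z hz
    rw [mem_ball_zero_iff] at hz
    refine hball ?_
    rw [mem_ball, dist_self_add_left, norm_smul, Real.norm_of_nonneg hs.le]
    gcongr
  refine ⟨(h.coeff.rescale hs hball).mono_const ?_, h.weak.rescale hs hball fun _ _ => rfl,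
    h.lip.comp_affine x s hop, h.cont.comp (by fun_prop) hcl, fun z hz => h.nonneg _ (hcl hz),
    mul_nonneg (sq_nonneg s) h.hM⟩
  exact mul_le_of_le_one_right h.coeff.hK.le (Real.rpow_le_one hs.le hs1 h.coeff.hγ.1.le)

set_option maxHeartbeats 2000000 in
/-- Linear growth from the boundary of the unit ball. -/
theorem exists_linear_growth (n : ℕ) {lam Lam γ K : ℝ} (hlam : 0 < lam) (hLam : lam ≤ Lam)
    (hγ : γ ∈ Ioo (0 : ℝ) 1) (hK : 0 < K) :
    ∃ c > (0 : ℝ), ∀ (A : EucSp n → (EucSp n →L[ℝ] EucSp n)) (v : EucSp n → ℝ) (M : ℝ),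
      NonnegSol A v lam Lam γ K M 0 1 → ∀ x ∈ closedBall (0 : EucSp n) 1,
        (c * v 0 - 2 * M) * (1 - ‖x‖) ≤ v x := by
  obtain ⟨C₁, hC₁, hmv⟩ := exists_mean_value n hlam hLam hγ hK
  obtain ⟨θ, hθ, hθ8, H, hH, hharnack⟩ := exists_harnack n hlam hLam hγ hK
  set β := γ / 2 with hβdef
  have hβ0 : 0 < β := half_pos hγ.1
  have hβ1 : β < 1 := by linarith [hγ.2]
  obtain ⟨c₂, hc₂, hbar⟩ := exists_average_barrier n hlam hLam (β := β) ⟨hβ0, hβ1⟩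
  set κ := θ / 4 with hκ
  have hκ0 : 0 < κ := by positivity
  set ε := κ ^ 2 * c₂ / (3 * κ ^ 2 + C₁ * (3 * H + 1)) with hε
  have hε0 : 0 < ε := by positivity
  set ρ := min (3 / 4) (ε ^ β⁻¹) with hρ
  have hρ0 : 0 < ρ := by positivity
  have hρ34 : ρ ≤ 3 / 4 := min_le_left _ _
  set k := ⌈2 / (θ * ρ)⌉₊ with hk
  refine ⟨1 / (2 * H ^ k), by positivity, ?_⟩
  intro A v M h x hx
  set m := 1 / (2 * H ^ k) * v 0 - M with hm
  have hM := h.hM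
  have hx1 : ‖x‖ ≤ 1 := mem_closedBall_zero_iff.1 hx
  rcases lt_or_ge m M with hmM | hmM
  · exact (mul_nonpos_of_nonpos_of_nonneg (by linarith) (by linarith)).trans (h.nonneg x hx)
  have hv0 := h.nonneg
  rcases (hM.trans hmM).eq_or_lt with hm0 | hm0
  · exact (mul_nonpos_of_nonpos_of_nonneg (by linarith) (by linarith)).trans (hv0 x hx)
  have hinner : ∀ y : EucSp n, ρ ≤ 1 - ‖y‖ ^ 2 → 2 * m ≤ v y := by
    intro y hy
    have hyn : ‖y‖ ≤ 1 - ρ / 2 :=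
      (sq_le_sq₀ (norm_nonneg y) (by linarith)).1 (by linarith [sq_nonneg ρ])
    have h1 := le_pow_mul_of_chain (u := fun p => v p + M) (H := H) (δ := θ * ρ / 2)
      (convex_closedBall (0 : EucSp n) (1 - ρ / 2)) (by linarith)
      (fun p hp q _ hpq => by
        rw [mem_closedBall_zero_iff] at hp
        have := hharnack A v 0 1 M le_rfl h.coeff h.weak h.lip h.cont hv0 hM p
          (by
            rw [mem_ball_zero_iff]
            linarith) q (hpq.trans (by
              rw [sub_zero, mul_div_assoc]
              gcongr
              linarith))
        simpa using this) k (mem_closedBall_zero_iff.2 hyn)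
      (mem_closedBall_self (by linarith)) (by
        rw [zero_sub, norm_neg]
        have h2 : 2 / (θ * ρ) ≤ k := Nat.le_ceil _
        calc ‖y‖ ≤ 2 / (θ * ρ) * (θ * ρ / 2) := by
              rw [div_mul_div_cancel₀ (by positivity)]
              linarith
          _ ≤ _ := by gcongr)
    have hHk : 0 < H ^ k := by positivity
    have h3 : 2 * m = v 0 / H ^ k - 2 * M := by
      rw [hm]
      field_simp
    have h4 : v 0 / H ^ k ≤ v y + M := by
      rw [div_le_iff₀ hHk]
      linarith
    linarith
  have hball : ∀ y ∈ closedBall (0 : EucSp n) 1, 0 ≤ 1 - ‖y‖ ^ 2 := fun y hy => by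
    rw [mem_closedBall_zero_iff] at hy
    nlinarith [norm_nonneg y]
  have hmain : ∀ y ∈ closedBall (0 : EucSp n) 1, m * barrier β y ≤ v y := by
    by_contra! hcon
    obtain ⟨w, hw, hw'⟩ := hcon
    have hcont : ContinuousOn (fun y => v y - m * barrier β y) (closedBall 0 1) :=
      h.cont.sub ((continuous_barrier hβ0).const_mul m).continuousOn
    obtain ⟨y, hy, hmin⟩ := (isCompact_closedBall (0 : EucSp n) 1).exists_isMinOn ⟨w, hw⟩ hcont
    have hneg : v y < m * barrier β y := by
      have : v y - m * barrier β y ≤ v w - m * barrier β w := hmin hw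
      linarith
    set D := 1 - ‖y‖ ^ 2 with hD
    set E := D ^ (1 + β) with hE
    have hWy : barrier β y = D + E := rfl
    have hD0 : 0 < D := by
      refine (hball y hy).lt_of_ne fun h0 => ?_
      have h0' : D = 0 := h0.symm
      rw [hWy, hE, h0', Real.zero_rpow (by positivity)] at hneg
      linarith [hv0 y hy]
    have hE0 : 0 < E := Real.rpow_pos_of_pos hD0 _
    have hD1 : D ≤ 1 := by linarith [sq_nonneg ‖y‖]
    have hED : E ≤ D := by
      simpa using Real.rpow_le_rpow_of_exponent_ge hD0 hD1 (show 1 ≤ 1 + β by linarith)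
    have hDρ : D < ρ := by
      by_contra! hcon'
      have := hinner y hcon'
      rw [hWy] at hneg
      have := mul_le_mul_of_nonneg_left (show D + E ≤ 2 by linarith) hm0.le
      linarith
    have hDβ : D ^ β < ε := by
      have := Real.rpow_lt_rpow hD0.le (hDρ.trans_le (min_le_right _ _)) hβ0
      rwa [← Real.rpow_mul hε0.le, inv_mul_cancel₀ hβ0.ne', Real.rpow_one] at this
    set d := 1 - ‖y‖ with hd
    have hy1 : ‖y‖ ≤ 1 := mem_closedBall_zero_iff.1 hy
    have hd0 : 0 < d := by
      have := (sq_lt_one_iff₀ (norm_nonneg y)).1 (by linarith)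
      linarith
    have hdD : d ≤ D := by linarith [pow_le_of_le_one (norm_nonneg y) hy1 two_ne_zero]
    have hDd : D ≤ 2 * d := by linarith [sq_nonneg (1 - ‖y‖)]
    have hd1 : d ≤ 1 := by linarith
    set s := κ * D with hs
    have hs0 : 0 < s := by positivity
    have hsd : 2 * s ≤ θ * d := by
      have := mul_le_mul_of_nonneg_left hDd hθ.le
      rw [hs, hκ]
      linarith
    have hsD : s ≤ D := mul_le_of_le_one_left hD0.le (by linarith)
    have hsub : closedBall y (2 * s) ⊆ ball 0 1 :=
      (closedBall_subset_ball (ε₂ := d)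
        (hsd.trans_lt (mul_lt_of_lt_one_left hd0 (by linarith)))).trans
        (ball_subset_ball' (by rw [dist_zero_right, hd, sub_add_cancel]))
    have hloc := h.rescale (x := y) (R' := 1) hd0 hd1 (by
      rw [sub_zero, mul_one, hd, sub_add_cancel])
    have hω : ∀ p ∈ ball y (2 * s), |v p - 0| ≤ 3 * H * m * D := by
      intro p hp
      rw [mem_ball, dist_eq_norm] at hp
      have hp0 := hv0 p (ball_subset_closedBall (hsub (ball_subset_closedBall
        (mem_ball_iff_norm.2 hp))))
      rw [sub_zero, abs_of_nonneg hp0]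
      have h1 := hharnack _ _ 0 1 _ le_rfl hloc.coeff hloc.weak hloc.lip hloc.cont hloc.nonneg
        hloc.hM 0 (mem_ball_self one_pos) (d⁻¹ • (p - y)) (by
          rw [sub_zero, sub_zero, norm_zero, sub_zero, mul_one, norm_smul, norm_inv,
            Real.norm_of_nonneg hd0.le, inv_mul_le_iff₀ hd0]
          linarith)
      rw [smul_smul, mul_inv_cancel₀ hd0.ne', one_smul, add_sub_cancel, smul_zero, add_zero,
        one_pow, mul_one] at h1
      have h2 : d ^ 2 * M ≤ D * m := by
        have : d ^ 2 ≤ D := (pow_le_of_le_one hd0.le hd1 two_ne_zero).trans hdD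
        gcongr
      have h3 : v y + d ^ 2 * M ≤ 3 * m * D := by
        rw [hWy] at hneg
        have := mul_le_mul_of_nonneg_left hED hm0.le
        linarith
      have h4 : 0 ≤ d ^ 2 * M := by positivity
      calc v p ≤ H * (v y + d ^ 2 * M) := by linarith
        _ ≤ H * (3 * m * D) := by gcongr
        _ = _ := by ring
    have hT := h.coeff.isEllMap (hsub (mem_closedBall_self (by positivity)))
    have h1 := hmv A v (ball 0 1) y M (3 * H * m * D) 0 s h.coeff h.weak h.lip hM (by positivity)
      hs0 (hsD.trans hD1) hsub hω
    have h2 := hbar (A y) y κ D hT hD hD0 (hDρ.le.trans hρ34) hκ0 (by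
      rw [hκ]
      linarith)
    have hsub1 : closedBall y s ⊆ closedBall 0 1 :=
      (closedBall_subset_closedBall (by linarith)).trans (hsub.trans ball_subset_closedBall)
    have h3 := le_integral_mul_ellKer hT (x := y) (a := 0) (b := 0) (c := v y - m * barrier β y)
      (m := 0) (continuousOn_comp_affine hs0.le (hcont.mono hsub1) le_rfl) fun z hz => by
        have : v y - m * barrier β y ≤ v (y + s • z) - m * barrier β (y + s • z) := hmin (hsub1 (by
          rw [mem_closedBall, dist_self_add_left, norm_smul, Real.norm_of_nonneg hs0.le]
          exact mul_le_of_le_one_right hs0.le hz))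
        linarith
    have h4 : ∫ z, (v (y + s • z) - m * barrier β (y + s • z)) * ellKer (A y) Lam z
        = (∫ z, v (y + s • z) * ellKer (A y) Lam z)
          - m * ∫ z, barrier β (y + s • z) * ellKer (A y) Lam z := by
      rw [← integral_const_mul, ← integral_sub]
      · congr 1 with z
        ring
      · exact hT.integrable_mul_ellKer
          (continuousOn_comp_affine hs0.le (h.cont.mono hsub1) le_rfl)
      · exact (hT.integrable_mul_ellKer (continuousOn_comp_affine hs0.le
          (continuous_barrier hβ0).continuousOn (le_refl s))).const_mul m
    rw [h4, zero_mul, add_zero] at h3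
    have h5 := (abs_le.1 h1).1
    have hEβ : D ^ (1 + γ) = D ^ β * E := by
      rw [hE, ← Real.rpow_add hD0]
      congr 1
      rw [hβdef]
      ring
    have hD2 : D ^ 2 ≤ D ^ β * E := by
      rw [← hEβ, ← Real.rpow_natCast]
      exact Real.rpow_le_rpow_of_exponent_ge hD0 hD1 (by push_cast; linarith [hγ.2])
    have hsγ : s ^ γ * D ≤ D ^ β * E := by
      rw [← hEβ, Real.rpow_add hD0, Real.rpow_one, mul_comm D]
      have := hγ.1
      gcongr
    have h6 : C₁ * (s ^ γ * (3 * H * m * D) + s ^ 2 * M)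
        ≤ m * (C₁ * (3 * H + 1) * (D ^ β * E)) := by
      have h7 : s ^ 2 * M ≤ (D ^ β * E) * m :=
        mul_le_mul ((by gcongr : s ^ 2 ≤ D ^ 2).trans hD2) hmM hM (by positivity)
      calc C₁ * (s ^ γ * (3 * H * m * D) + s ^ 2 * M)
          = C₁ * (3 * H * m * (s ^ γ * D) + s ^ 2 * M) := by ring
        _ ≤ C₁ * (3 * H * m * (s ^ γ * D) + (D ^ β * E) * m) := by gcongr
        _ ≤ C₁ * (3 * H * m * (D ^ β * E) + (D ^ β * E) * m) := by gcongr
        _ = _ := by ring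
    have h8 : m * (κ ^ 2 * (c₂ * E - 3 * D ^ 2)) ≤ m * (C₁ * (3 * H + 1) * (D ^ β * E)) := by
      have := mul_le_mul_of_nonneg_left h2 hm0.le
      linarith
    have h9 := le_of_mul_le_mul_left h8 hm0
    have h10 : κ ^ 2 * c₂ * E ≤ (3 * κ ^ 2 + C₁ * (3 * H + 1)) * D ^ β * E := by
      have := mul_le_mul_of_nonneg_left hD2 (show 0 ≤ 3 * κ ^ 2 by positivity)
      linarith
    have h11 := le_of_mul_le_mul_right h10 hE0
    have h12 : ε ≤ D ^ β := by
      rw [hε, div_le_iff₀ (by positivity)]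
      linarith
    linarith
  refine le_trans ?_ (hmain x hx)
  have h1 : 1 - ‖x‖ ≤ barrier β x := by
    have h2 : 0 ≤ (1 - ‖x‖ ^ 2) ^ (1 + β) := Real.rpow_nonneg (hball x hx) _
    have h3 : 1 - ‖x‖ ≤ 1 - ‖x‖ ^ 2 := by
      linarith [pow_le_of_le_one (norm_nonneg x) hx1 two_ne_zero]
    rw [barrier]
    linarith
  exact mul_le_mul (by linarith) h1 (by linarith) hm0.le

/-- **Lemma 2.1 (Barrier lemma).** A nonnegative solution of `𝓛v = f` in a ball
vanishing at a boundary point `y₀` grows linearly from `y₀` with slope at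
least `c̄ v(x₀)/r − C̄ r ‖f‖_∞`. -/
theorem barrier_lemma
    (n : ℕ) (hn : 2 ≤ n) (γ lam Lam K : ℝ)
    (hγ : γ ∈ Set.Ioo (0:ℝ) 1) (hlam : 0 < lam) (hlamLam : lam ≤ Lam) (hK : 0 < K) :
    ∃ cbar > (0:ℝ), ∃ Cbar > (0:ℝ),
      ∀ (A : EucSp n → (EucSp n →L[ℝ] EucSp n)) (x₀ : EucSp n) (r : ℝ),
        0 < r → r ≤ 1 →
        IsElliptic A lam Lam (ball x₀ r) → IsSymmCoeff A (ball x₀ r) →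
        HolderSemi A γ K (ball x₀ r) →
        ∀ (f : EucSp n → ℝ) (M : ℝ), (∀ x ∈ ball x₀ r, |f x| ≤ M) →
        ∀ v : EucSp n → ℝ, ContinuousOn v (closedBall x₀ r) →
          LocLipOn v (ball x₀ r) → (∀ x ∈ closedBall x₀ r, 0 ≤ v x) →
          WeakEq A v f (ball x₀ r) →
          ∀ y₀ ∈ sphere x₀ r, v y₀ = 0 →
            ∃ α : ℝ, cbar * v x₀ / r - Cbar * r * M ≤ α ∧
              ExpandGe v y₀ (nuRight y₀ x₀) α (ball x₀ r) := by
  obtain ⟨c, hc, hgrow⟩ := exists_linear_growth n hlam hlamLam hγ hK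
  refine ⟨c, hc, 2, two_pos, ?_⟩
  intro A x₀ r hr hr1 hell hsymm hhol f M hf v hcont hlip hv0 hweak y₀ hy₀ _
  have hM : 0 ≤ M := (abs_nonneg _).trans (hf x₀ (mem_ball_self hr))
  have hsol : NonnegSol A v lam Lam γ K M x₀ r :=
    ⟨⟨hlam, hlamLam, hγ, hK, hell, hsymm, hhol⟩, hweak.weakBdd measurableSet_ball hM hf, hlip,
      hcont, hv0, hM⟩
  set a := c * v x₀ / r - 2 * r * M with ha
  have hlin : ∀ x ∈ ball x₀ r, a * (r - ‖x - x₀‖) ≤ v x := by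
    intro x hx
    rw [mem_ball, dist_eq_norm] at hx
    have hz : ‖r⁻¹ • (x - x₀)‖ = ‖x - x₀‖ / r := by
      rw [norm_smul, norm_inv, Real.norm_of_nonneg hr.le]
      field_simp
    have h := hgrow _ _ _ (hsol.rescale (x := x₀) (R' := 1) hr hr1 (by simp)) (r⁻¹ • (x - x₀))
      (by
        rw [mem_closedBall_zero_iff, hz, div_le_one hr]
        exact hx.le)
    rw [hz, smul_zero, add_zero, smul_smul, mul_inv_cancel₀ hr.ne', one_smul,
      add_sub_cancel] at h
    refine le_trans (le_of_eq ?_) h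
    rw [ha]
    field_simp
  refine ⟨max a 0, le_max_left _ _, fun ε hε => ?_⟩
  have hlin' : ∀ x ∈ ball x₀ r, max a 0 * (r - ‖x - x₀‖) ≤ v x := fun x hx => by
    rcases max_cases a 0 with ⟨h, -⟩ | ⟨h, -⟩ <;> rw [h]
    · exact hlin x hx
    · rw [zero_mul]
      exact hv0 x (ball_subset_closedBall hx)
  set α := max a 0 with hα
  have hα0 : 0 ≤ α := le_max_right _ _
  have hδ : 0 < 2 * r * ε / (α + 1) := by positivity
  filter_upwards [self_mem_nhdsWithin, mem_nhdsWithin_of_mem_nhds (ball_mem_nhds y₀ hδ)]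
    with x hx hxy
  refine le_trans ?_ (hlin' x hx)
  rw [mem_ball, dist_eq_norm, lt_div_iff₀ (by positivity)] at hxy
  rw [mem_ball, dist_eq_norm] at hx
  have hy : ‖x₀ - y₀‖ = r := by
    rw [mem_sphere, dist_eq_norm, norm_sub_rev] at hy₀
    exact hy₀
  set t := ‖x - y₀‖ with ht
  have ht0 : 0 ≤ t := norm_nonneg _
  have hpos : 0 ≤ r - ‖x - x₀‖ := by linarith
  have hin : ⟪x - y₀, nuRight y₀ x₀⟫ = r⁻¹ * ⟪x - y₀, x₀ - y₀⟫ := by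
    rw [nuRight, hy, inner_smul_right]
  have hsq : ‖x - x₀‖ ^ 2 = t ^ 2 - 2 * ⟪x - y₀, x₀ - y₀⟫ + r ^ 2 := by
    rw [← sub_sub_sub_cancel_right x x₀ y₀, norm_sub_sq_real, hy]
  have hkey : max ⟪x - y₀, nuRight y₀ x₀⟫ 0 ≤ (r - ‖x - x₀‖) + t ^ 2 / (2 * r) := by
    refine max_le ?_ (by positivity)
    rw [hin, inv_mul_le_iff₀ hr]
    have e : r * ((r - ‖x - x₀‖) + t ^ 2 / (2 * r)) = r * (r - ‖x - x₀‖) + t ^ 2 / 2 := by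
      field_simp
    rw [e]
    nlinarith [sq_nonneg (r - ‖x - x₀‖)]
  have h1 : α * (t ^ 2 / (2 * r)) ≤ ε * t := by
    rw [← mul_div_assoc, div_le_iff₀ (by positivity)]
    nlinarith
  have h2 := mul_le_mul_of_nonneg_left hkey hα0
  linarith
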